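/- arXiv:2407.20953 — 2 statements merged into one kernel-verified Lean document; each statement's English description precedes it below -/
import Mathlib

section
/- The family of indicator functions (1_{⟨B⟩})_{B ∈ φ(V_D)} is a ℂ-basis of ℂ[V_D]; moreover, for B, B' ∈ φ(V_D), if ε(B') ∈ ⟨B⟩ then B' ≤ B. -/
open scoped BigOperators

/-- `W D` : functions `Z/(D+1) → F₂`. -/
abbrev Wsp (D : ℕ) : Type := ZMod (D + 1) → ZMod 2

/-- The all-ones function. -/
def allOnes (D : ℕ) : Wsp D := fun _ => 1

/-- `V D = W/span{u}`. -/
abbrev Vsp (D : ℕ) : Type := Wsp D ⧸ Submodule.span (ZMod 2) {allOnes D}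

/-- `e i` : image of the standard basis function at `i`. -/
def eV (D : ℕ) (i : ZMod (D + 1)) : Vsp D :=
  Submodule.Quotient.mk (Pi.single i 1)

/-- `e_I = ∑_{s ∈ I} e_s`. -/
def eSet (D : ℕ) (I : Finset (ZMod (D + 1))) : Vsp D := ∑ s ∈ I, eV D s

/-- A cyclic interval (arc): nonempty proper subset of the form `{i, i+1, …, j}`. -/
def IsInterval (D : ℕ) (I : Finset (ZMod (D + 1))) : Prop :=
  ∃ (i : ZMod (D + 1)) (l : ℕ), 1 ≤ l ∧ l ≤ D ∧
    I = (Finset.range l).image (fun t : ℕ => i + (t : ZMod (D + 1)))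

/-- Member of `ℐ¹` : interval of odd cardinality. -/
def OddInterval (D : ℕ) (I : Finset (ZMod (D + 1))) : Prop :=
  IsInterval D I ∧ Odd I.card

/-- `I ≺ I'` : `I ⊊ I'` and `I' − I` is a disjoint union of two intervals. -/
def Prec (D : ℕ) (I I' : Finset (ZMod (D + 1))) : Prop :=
  I ⊂ I' ∧ ∃ I₁ I₂, IsInterval D I₁ ∧ IsInterval D I₂ ∧ Disjoint I₁ I₂ ∧ I' \ I = I₁ ∪ I₂

/-- `I ♠ I'` : `I ∩ I' = ∅` and `I ∪ I'` is not an interval. -/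
def Spade (D : ℕ) (I I' : Finset (ZMod (D + 1))) : Prop :=
  I ∩ I' = ∅ ∧ ¬ IsInterval D (I ∪ I')

/-- `I^ev`. -/
noncomputable def evSet (D : ℕ) (I : Finset (ZMod (D + 1))) : Finset (ZMod (D + 1)) :=
  @Finset.filter _
    (fun i => ∃ I' I'', OddInterval D I' ∧ OddInterval D I'' ∧ Spade D I' I'' ∧
      I.erase i = I' ∪ I'')
    (Classical.decPred _) I

/-- `B ∈ φ(V_D)` : a finite set of elements of `ℐ¹` satisfying (P0) and (P1). -/
def phi (D : ℕ) (B : Finset (Finset (ZMod (D + 1)))) : Prop :=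
  (∀ I ∈ B, OddInterval D I) ∧
  (∀ I ∈ B, ∀ I' ∈ B, I = I' ∨ Spade D I I' ∨ Prec D I I' ∨ Prec D I' I) ∧
  (∀ I ∈ B, ∃ 𝒥 : Finset (Finset (ZMod (D + 1))), 𝒥 ⊆ B ∧
    (∀ J ∈ 𝒥, Prec D J I) ∧
    (∀ J ∈ 𝒥, ∀ J' ∈ 𝒥, J ≠ J' → Disjoint J J') ∧
    evSet D I ⊆ 𝒥.biUnion id)

/-- `⟨B⟩` : the F₂-span of `{e_I : I ∈ B}`. -/
def spanB (D : ℕ) (B : Finset (Finset (ZMod (D + 1)))) : Submodule (ZMod 2) (Vsp D) :=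
  Submodule.span (ZMod 2) (eSet D '' ↑B)

/-- `g_i(B) = |{I ∈ B : i ∈ I}|`. -/
def gB (D : ℕ) (B : Finset (Finset (ZMod (D + 1)))) (i : ZMod (D + 1)) : ℕ :=
  (B.filter (fun I => i ∈ I)).card

/-- `ε(B) = ∑_i (g_i(B)(g_i(B)+1)/2 mod 2) e_i`. -/
def epsB (D : ℕ) (B : Finset (Finset (ZMod (D + 1)))) : Vsp D :=
  ∑ i : ZMod (D + 1), ((gB D B i * (gB D B i + 1) / 2 : ℕ) : ZMod 2) • eV D i

/-- The partial order `B' ≤ B` on `φ(V_D)`. -/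
def leφ (D : ℕ) (B' B : Finset (Finset (ZMod (D + 1)))) : Prop :=
  ∃ (k : ℕ) (c : ℕ → Finset (Finset (ZMod (D + 1)))),
    c 0 = B' ∧ c k = B ∧ (∀ s ≤ k, phi D (c s)) ∧
    ∀ s < k, epsB D (c s) ∈ spanB D (c (s + 1))

/-- `B' < B`. -/
def ltφ (D : ℕ) (B' B : Finset (Finset (ZMod (D + 1)))) : Prop :=
  leφ D B' B ∧ B' ≠ B

/-- `1_E ∈ ℂ[V_D]`, the indicator function of `E ⊆ V_D`. -/
noncomputable def ind (D : ℕ) (E : Set (Vsp D)) : Vsp D → ℂ := E.indicator 1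

/-- `δ_x ∈ ℂ[V_D]`. -/
noncomputable def delta (D : ℕ) (x : Vsp D) : Vsp D → ℂ := ind D {x}

/-- The symplectic form on `W`. -/
def formW (D : ℕ) (x y : Wsp D) : ZMod 2 :=
  ∑ i : ZMod (D + 1), (x i * y (i + 1) + x (i + 1) * y i)

/-- The induced symplectic form on `V_D` (well defined since the form kills `u`). -/
noncomputable def formV (D : ℕ) (x y : Vsp D) : ZMod 2 :=
  formW D (Quotient.out x) (Quotient.out y)

/-- The Fourier transform `ℂ[V_D] → ℂ[V_D]`. -/
noncomputable def fourierV (D : ℕ) (f : Vsp D → ℂ) : Vsp D → ℂ :=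
  fun y => (2 : ℂ) ^ (-((D / 2 : ℕ) : ℤ)) *
    ∑ᶠ x : Vsp D, (if formV D x y = 0 then (1 : ℂ) else -1) * f x

/-- The target in `V_D` of the basis vector `e'_ℓ` of `V_{D-2}` under `τ_j`. -/
noncomputable def tauTgt (D j : ℕ) (ℓ : ZMod (D - 2 + 1)) : Vsp D :=
  let L : ℕ := if ℓ.val = 0 then D - 1 else ℓ.val
  if ℓ = ((j - 1 : ℕ) : ZMod (D - 2 + 1)) then
    eV D ((j : ZMod (D + 1)) - 1) + eV D (j : ZMod (D + 1)) + eV D ((j : ZMod (D + 1)) + 1)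
  else if L < j - 1 then eV D (L : ZMod (D + 1))
  else eV D ((L + 2 : ℕ) : ZMod (D + 1))

/-- The linear embedding `τ_j : V_{D-2} → V_D` (well defined independently of the chosen
representative since the targets sum to `0`). -/
noncomputable def tauMap (D j : ℕ) (x : Vsp (D - 2)) : Vsp D :=
  ∑ i : ZMod (D - 2 + 1), (Quotient.out x) i • tauTgt D j i

/-! ### Arcs of the cycle, described by integer endpoints -/

/-- The arc `{a + 1, …, b}` of the cycle `Z/(D+1)`, for integers `a` and `b`. -/
noncomputable def arc (D : ℕ) (a b : ℤ) : Finset (ZMod (D + 1)) :=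
  (Finset.Ioc a b).image (fun x : ℤ => (x : ZMod (D + 1)))

lemma mem_arc {D : ℕ} {a b : ℤ} {z : ZMod (D + 1)} :
    z ∈ arc D a b ↔ ∃ x : ℤ, a < x ∧ x ≤ b ∧ (x : ZMod (D + 1)) = z := by
  simp [arc, and_assoc]

lemma eq_of_cast_eq {D : ℕ} {a x y : ℤ} (hx : a < x) (hx' : x ≤ a + (D + 1)) (hy : a < y)
    (hy' : y ≤ a + (D + 1)) (h : (x : ZMod (D + 1)) = y) : x = y := by
  rw [ZMod.intCast_eq_intCast_iff_dvd_sub] at h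
  have h0 := Int.eq_zero_of_abs_lt_dvd h (by push_cast; rw [abs_lt]; constructor <;> linarith)
  linarith

lemma exists_lift {D : ℕ} (a : ℤ) (z : ZMod (D + 1)) :
    ∃ x : ℤ, a < x ∧ x ≤ a + (D + 1) ∧ (x : ZMod (D + 1)) = z := by
  obtain ⟨y, rfl⟩ := ZMod.intCast_surjective z
  have hn : (0 : ℤ) < D + 1 := by positivity
  refine ⟨a + 1 + (y - (a + 1)) % (D + 1), ?_, ?_, ?_⟩
  · linarith [Int.emod_nonneg (y - (a + 1)) hn.ne']
  · linarith [Int.emod_lt_of_pos (y - (a + 1)) hn]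
  · rw [ZMod.intCast_eq_intCast_iff_dvd_sub]
    refine ⟨(y - (a + 1)) / (D + 1), ?_⟩
    push_cast
    linarith [Int.emod_add_mul_ediv (y - (a + 1)) (D + 1)]

lemma cast_add_mul (D : ℕ) (x k : ℤ) :
    ((x + k * (D + 1) : ℤ) : ZMod (D + 1)) = (x : ZMod (D + 1)) := by
  rw [ZMod.intCast_eq_intCast_iff_dvd_sub]
  exact ⟨-k, by push_cast; ring⟩

lemma cast_add_period (D : ℕ) (x : ℤ) :
    ((x + (D + 1) : ℤ) : ZMod (D + 1)) = (x : ZMod (D + 1)) := by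
  simp

lemma exists_eq_add_mul {D : ℕ} {x y : ℤ} (h : (x : ZMod (D + 1)) = y) :
    ∃ k : ℤ, y = x + k * (D + 1) := by
  rw [ZMod.intCast_eq_intCast_iff_dvd_sub] at h
  obtain ⟨k, hk⟩ := h
  exact ⟨k, by push_cast at hk; linarith⟩

lemma cast_mem_arc {D : ℕ} {a b x : ℤ} (hb : b ≤ a + (D + 1)) (hx : a < x)
    (hx' : x ≤ a + (D + 1)) : (x : ZMod (D + 1)) ∈ arc D a b ↔ x ≤ b := by
  rw [mem_arc]
  constructor
  · rintro ⟨y, hy, hyb, h⟩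
    exact (eq_of_cast_eq hy (by linarith) hx hx' h) ▸ hyb
  · exact fun h => ⟨x, hx, h, rfl⟩

lemma cast_left_notMem_arc {D : ℕ} {a b : ℤ} (hb : b < a + (D + 1)) :
    (a : ZMod (D + 1)) ∉ arc D a b := by
  rw [← cast_add_period, cast_mem_arc hb.le (by linarith) le_rfl]
  linarith

lemma arc_add_mul (D : ℕ) (a b k : ℤ) :
    arc D (a + k * (D + 1)) (b + k * (D + 1)) = arc D a b := by
  ext z
  simp only [mem_arc]
  constructor
  · rintro ⟨x, h1, h2, rfl⟩
    refine ⟨x + (-k) * (D + 1), by linarith, by linarith, cast_add_mul _ _ _⟩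
  · rintro ⟨x, h1, h2, rfl⟩
    exact ⟨x + k * (D + 1), by linarith, by linarith, cast_add_mul _ _ _⟩

lemma arc_add_period (D : ℕ) (a b : ℤ) : arc D (a + (D + 1)) (b + (D + 1)) = arc D a b := by
  simpa using arc_add_mul D a b 1

lemma arc_union {D : ℕ} {a b c : ℤ} (hab : a ≤ b) (hbc : b ≤ c) :
    arc D a b ∪ arc D b c = arc D a c := by
  rw [arc, arc, ← Finset.image_union, Finset.Ioc_union_Ioc_eq_Ioc hab hbc, arc]

lemma arc_disjoint {D : ℕ} {a b c d : ℤ} (hbc : b ≤ c) (hda : d ≤ a + (D + 1)) :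
    Disjoint (arc D a b) (arc D c d) := by
  rw [Finset.disjoint_left]
  intro z h1 h2
  obtain ⟨x, hx, hx', rfl⟩ := mem_arc.1 h1
  obtain ⟨y, hy, hy', h⟩ := mem_arc.1 h2
  have := eq_of_cast_eq (a := a) (by linarith) (by linarith) hx (by linarith) h
  linarith

lemma card_arc {D : ℕ} {a b : ℤ} (hb : b ≤ a + (D + 1)) : (arc D a b).card = (b - a).toNat := by
  rw [arc, Finset.card_image_of_injOn, Int.card_Ioc]
  intro x hx y hy h
  simp only [Finset.coe_Ioc, Set.mem_Ioc] at hx hy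
  exact eq_of_cast_eq (a := a) hx.1 (by linarith) hy.1 (by linarith) h

lemma arc_eq_image (D : ℕ) (a : ℤ) (l : ℕ) :
    arc D a (a + l) = (Finset.range l).image
      (fun t : ℕ => ((a + 1 : ℤ) : ZMod (D + 1)) + (t : ZMod (D + 1))) := by
  ext z
  simp only [mem_arc, Finset.mem_image, Finset.mem_range]
  constructor
  · rintro ⟨x, h1, h2, rfl⟩
    refine ⟨(x - (a + 1)).toNat, by omega, ?_⟩
    obtain ⟨t, ht⟩ := Int.eq_ofNat_of_zero_le (show 0 ≤ x - (a + 1) by omega)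
    rw [ht, Int.toNat_natCast, show x = a + 1 + t by omega]
    push_cast
    ring
  · rintro ⟨t, ht, rfl⟩
    exact ⟨a + 1 + t, by omega, by omega, by push_cast; ring⟩

lemma isInterval_arc {D : ℕ} {a b : ℤ} (hab : a < b) (hb : b < a + (D + 1)) :
    IsInterval D (arc D a b) := by
  obtain ⟨l, hl⟩ := Int.eq_ofNat_of_zero_le (show 0 ≤ b - a by omega)
  obtain rfl : b = a + l := by omega
  exact ⟨_, l, by omega, by omega, arc_eq_image D a l⟩

lemma IsInterval.exists_arc {D : ℕ} {I : Finset (ZMod (D + 1))} (h : IsInterval D I) :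
    ∃ a b : ℤ, a < b ∧ b < a + (D + 1) ∧ I = arc D a b := by
  obtain ⟨i, l, h1, h2, rfl⟩ := h
  obtain ⟨x, rfl⟩ := ZMod.intCast_surjective i
  refine ⟨x - 1, x - 1 + l, by omega, by omega, ?_⟩
  rw [arc_eq_image, sub_add_cancel]

lemma oddInterval_arc {D : ℕ} {a b : ℤ} (hab : a < b) (hb : b < a + (D + 1)) (ho : Odd (b - a)) :
    OddInterval D (arc D a b) := by
  refine ⟨isInterval_arc hab hb, ?_⟩
  rw [card_arc hb.le]
  obtain ⟨k, hk⟩ := ho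
  exact ⟨k.toNat, by omega⟩

lemma OddInterval.exists_arc {D : ℕ} {I : Finset (ZMod (D + 1))} (h : OddInterval D I) :
    ∃ a b : ℤ, a < b ∧ b < a + (D + 1) ∧ Odd (b - a) ∧ I = arc D a b := by
  obtain ⟨a, b, hab, hb, rfl⟩ := h.1.exists_arc
  refine ⟨a, b, hab, hb, ?_, rfl⟩
  have := h.2
  rw [card_arc hb.le] at this
  obtain ⟨k, hk⟩ := this
  exact ⟨k, by omega⟩

/-- An odd arc inside `arc D a b` has integer endpoints inside `[a, b]`. -/
lemma OddInterval.exists_arc_of_subset {D : ℕ} {I : Finset (ZMod (D + 1))} (h : OddInterval D I)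
    {a b : ℤ} (hb : b < a + (D + 1)) (hI : I ⊆ arc D a b) :
    ∃ p q : ℤ, a ≤ p ∧ p < q ∧ q ≤ b ∧ Odd (q - p) ∧ I = arc D p q := by
  obtain ⟨c, d, hcd, hd, ho, rfl⟩ := h.exists_arc
  have h1 : ((c + 1 : ℤ) : ZMod (D + 1)) ∈ arc D c d := mem_arc.2 ⟨c + 1, by omega, by omega, rfl⟩
  obtain ⟨x, hx, hxb, hxc⟩ := mem_arc.1 (hI h1)
  obtain ⟨k, hk⟩ := exists_eq_add_mul hxc.symm
  have hs : arc D (x - 1) (d + k * (D + 1)) = arc D c d := by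
    rw [← arc_add_mul D c d k]
    congr 1
    omega
  have hdx : d + k * (D + 1) - (x - 1) = d - c := by rw [hk]; ring
  refine ⟨x - 1, d + k * (D + 1), by omega, by omega, ?_, by rwa [hdx], hs.symm⟩
  by_contra! hlt
  have hm : ((b + 1 : ℤ) : ZMod (D + 1)) ∈ arc D c d := by
    rw [← hs]
    exact mem_arc.2 ⟨b + 1, by omega, by omega, rfl⟩
  have := (cast_mem_arc hb.le (by omega) (by omega)).1 (hI hm)
  omega

/-- A proper arc has only one right end. -/
lemma IsInterval.right_end_unique {D : ℕ} {I : Finset (ZMod (D + 1))} (h : IsInterval D I)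
    {x y : ZMod (D + 1)} (hx : x ∈ I) (hx' : x + 1 ∉ I) (hy : y ∈ I) (hy' : y + 1 ∉ I) :
    x = y := by
  obtain ⟨a, b, hab, hb, rfl⟩ := h.exists_arc
  have key : ∀ z : ZMod (D + 1), z ∈ arc D a b → z + 1 ∉ arc D a b → z = (b : ZMod (D + 1)) := by
    intro z hz hz'
    obtain ⟨t, h1, h2, rfl⟩ := mem_arc.1 hz
    rcases h2.eq_or_lt with rfl | h2
    · rfl
    · exact absurd (mem_arc.2 ⟨t + 1, by omega, by omega, by push_cast; rfl⟩) hz'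
  rw [key x hx hx', key y hy hy']

lemma spade_arc {D : ℕ} {p q p' q' : ℤ} (hpq : p < q) (hqp : q < p') (hpq' : p' < q')
    (hq : q' < p + (D + 1)) : Spade D (arc D p q) (arc D p' q') := by
  refine ⟨Finset.disjoint_iff_inter_eq_empty.1 (arc_disjoint hqp.le hq.le), fun h => ?_⟩
  have m1 := fun x h1 h2 => cast_mem_arc (D := D) (a := p) (b := q) (x := x) (by omega) h1 h2
  have m2 := fun x h1 h2 => cast_mem_arc (D := D) (a := p') (b := q') (x := x) (by omega) h1 h2
  have e : ((q : ℤ) : ZMod (D + 1)) = (q' : ZMod (D + 1)) := by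
    apply h.right_end_unique
    · rw [Finset.mem_union, m1 q (by omega) (by omega)]
      exact Or.inl le_rfl
    · rw [Finset.mem_union, show ((q : ℤ) : ZMod (D + 1)) + 1 = ((q + 1 : ℤ) : ZMod (D + 1)) by
        push_cast; rfl, m1 (q + 1) (by omega) (by omega), ← cast_add_period,
        m2 _ (by omega) (by omega)]
      omega
    · rw [Finset.mem_union, m2 q' (by omega) (by omega)]
      exact Or.inr le_rfl
    · rw [Finset.mem_union, show ((q' : ℤ) : ZMod (D + 1)) + 1 = ((q' + 1 : ℤ) : ZMod (D + 1)) by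
        push_cast; rfl, m1 (q' + 1) (by omega) (by omega), m2 _ (by omega) (by omega)]
      omega
  have := eq_of_cast_eq (a := p) (by omega) (by omega) (by omega) (by omega) e
  omega

lemma prec_arc {D : ℕ} {p q p' q' : ℤ} (hp : p' < p) (hpq : p < q) (hq : q < q')
    (hq' : q' < p' + (D + 1)) : Prec D (arc D p q) (arc D p' q') := by
  have d1 : Disjoint (arc D p' p) (arc D q q') := arc_disjoint hpq.le hq'.le
  have d2 : Disjoint (arc D p' p) (arc D p q) := arc_disjoint le_rfl (by omega)
  have d3 : Disjoint (arc D p q) (arc D q q') := arc_disjoint le_rfl (by omega)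
  have e : arc D p' q' = (arc D p' p ∪ arc D p q) ∪ arc D q q' := by
    rw [arc_union hp.le hpq.le, arc_union (by omega) hq.le]
  refine ⟨⟨?_, fun h => ?_⟩, arc D p' p, arc D q q', isInterval_arc hp (by omega),
    isInterval_arc hq (by omega), d1, ?_⟩
  · rw [e]
    exact Finset.subset_union_right.trans Finset.subset_union_left
  · exact Finset.disjoint_left.1 d3
      (h (mem_arc.2 ⟨q', by omega, le_rfl, rfl⟩)) (mem_arc.2 ⟨q', by omega, le_rfl, rfl⟩)
  · ext z
    have h2 : z ∈ arc D p' p → z ∉ arc D p q := fun h => Finset.disjoint_left.1 d2 h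
    have h3 : z ∈ arc D p q → z ∉ arc D q q' := fun h => Finset.disjoint_left.1 d3 h
    rw [e]
    simp only [Finset.mem_sdiff, Finset.mem_union]
    tauto

/-- The elements of `I^ev` sit at even positions of the arc `I`. -/
lemma mem_evSet_arc {D : ℕ} {a b x : ℤ} (hb : b < a + (D + 1)) (hx : a < x) (hxb : x ≤ b) :
    (x : ZMod (D + 1)) ∈ evSet D (arc D a b) ↔ Even (x - a) ∧ Odd (b - x) := by
  have m := fun y h1 h2 => cast_mem_arc (D := D) (a := a) (b := b) (x := y) hb.le h1 h2
  simp only [evSet, Finset.mem_filter]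
  constructor
  · rintro ⟨-, I, J, hI, hJ, hs, he⟩
    have hIs : I ⊆ arc D a b := fun z hz =>
      Finset.mem_of_mem_erase (he ▸ Finset.mem_union_left _ hz)
    have hJs : J ⊆ arc D a b := fun z hz =>
      Finset.mem_of_mem_erase (he ▸ Finset.mem_union_right _ hz)
    obtain ⟨p, q, hp, hpq, hq, ho, rfl⟩ := hI.exists_arc_of_subset hb hIs
    obtain ⟨r, s, hr, hrs, hsb, ho', rfl⟩ := hJ.exists_arc_of_subset hb hJs
    have mI : ∀ y : ℤ, a < y → y ≤ b → ((y : ZMod (D + 1)) ∈ arc D p q ↔ p < y ∧ y ≤ q) := by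
      intro y h1 h2
      rcases lt_or_ge p y with h | h
      · rw [cast_mem_arc (by omega) h (by omega)]
        tauto
      · rw [← cast_add_period, cast_mem_arc (by omega) (by omega) (by omega)]
        omega
    have mJ : ∀ y : ℤ, a < y → y ≤ b → ((y : ZMod (D + 1)) ∈ arc D r s ↔ r < y ∧ y ≤ s) := by
      intro y h1 h2
      rcases lt_or_ge r y with h | h
      · rw [cast_mem_arc (by omega) h (by omega)]
        tauto
      · rw [← cast_add_period, cast_mem_arc (by omega) (by omega) (by omega)]
        omega
    have key : ∀ y : ℤ, a < y → y ≤ b → (y ≠ x ↔ (p < y ∧ y ≤ q) ∨ (r < y ∧ y ≤ s)) := by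
      intro y h1 h2
      rw [← mI y h1 h2, ← mJ y h1 h2, ← Finset.mem_union, ← he, Finset.mem_erase,
        m y h1 (by omega)]
      constructor
      · exact fun h => ⟨fun h' => h (eq_of_cast_eq (a := a) h1 (by omega) hx (by omega) h'), h2⟩
      · rintro ⟨h, -⟩ rfl
        exact h rfl
    have hdis : ∀ y : ℤ, a < y → y ≤ b → ¬ ((p < y ∧ y ≤ q) ∧ (r < y ∧ y ≤ s)) := by
      intro y h1 h2
      rw [← mI y h1 h2, ← mJ y h1 h2, ← Finset.mem_inter, hs.1]
      simp
    have hqr : q ≠ r := by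
      rintro rfl
      exact hs.2 (by rw [arc_union hpq.le hrs.le]; exact isInterval_arc (by omega) (by omega))
    have hsp : s ≠ p := by
      rintro rfl
      exact hs.2 (by
        rw [Finset.union_comm, arc_union hrs.le hpq.le]
        exact isInterval_arc (by omega) (by omega))
    have k1 := key (q + 1) (by omega)
    have k2 := key (s + 1) (by omega)
    have k3 := key (p)
    have k4 := key (r)
    have k5 := hdis (p + 1) (by omega) (by omega)
    have k6 := hdis (r + 1) (by omega) (by omega)
    have k7 := key x hx hxb
    obtain ⟨u, hu⟩ := ho
    obtain ⟨v, hv⟩ := ho'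
    rcases lt_or_ge p r with h | h
    · have : q < r := by omega
      have : x = q + 1 := by omega
      have : x = r := by omega
      have : p = a := by omega
      have : s = b := by omega
      exact ⟨⟨u + 1, by omega⟩, ⟨v, by omega⟩⟩
    · have : s < p := by omega
      have : x = s + 1 := by omega
      have : x = p := by omega
      have : r = a := by omega
      have : q = b := by omega
      exact ⟨⟨v + 1, by omega⟩, ⟨u, by omega⟩⟩
  · rintro ⟨⟨u, hu⟩, ⟨v, hv⟩⟩
    refine ⟨(m x hx (by omega)).2 hxb, arc D a (x - 1), arc D x b,
      oddInterval_arc (by omega) (by omega) ⟨u - 1, by omega⟩,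
      oddInterval_arc (by omega) (by omega) ⟨v, by omega⟩,
      spade_arc (by omega) (by omega) (by omega) (by omega), ?_⟩
    ext z
    obtain ⟨y, h1, h2, rfl⟩ := exists_lift a z
    rw [Finset.mem_erase, Finset.mem_union, m y h1 h2, cast_mem_arc (by omega) h1 h2]
    have hxy : (y : ZMod (D + 1)) = (x : ZMod (D + 1)) ↔ y = x :=
      ⟨eq_of_cast_eq h1 h2 hx (by omega), fun h => by rw [h]⟩
    rw [Ne, hxy]
    rcases lt_or_ge x y with h | h
    · rw [cast_mem_arc (by omega) h (by omega)]
      omega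
    · rw [← cast_add_period, cast_mem_arc (by omega) (by omega) (by omega)]
      omega

/-! ### The endpoints of the members of an element of `φ(V_D)` -/

namespace phi

variable {D : ℕ} {B : Finset (Finset (ZMod (D + 1)))}

/-- Two members of `B` are never adjacent. -/
lemma not_adjacent (h : phi D B) (hD : Even D) {a b c : ℤ} (hab : a < b) (hbc : b < c)
    (hc : c ≤ a + (D + 1)) (ho : Odd (b - a)) (ho' : Odd (c - b)) (h1 : arc D a b ∈ B)
    (h2 : arc D b c ∈ B) : False := by
  have hd : Disjoint (arc D a b) (arc D b c) := arc_disjoint le_rfl hc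
  have m1 : ((a + 1 : ℤ) : ZMod (D + 1)) ∈ arc D a b := mem_arc.2 ⟨a + 1, by omega, by omega, rfl⟩
  have m2 : ((b + 1 : ℤ) : ZMod (D + 1)) ∈ arc D b c := mem_arc.2 ⟨b + 1, by omega, by omega, rfl⟩
  rcases h.2.1 _ h1 _ h2 with e | e | e | e
  · rw [← e] at hd m2
    exact Finset.disjoint_left.1 hd m1 m1
  · refine e.2 ?_
    rw [arc_union hab.le hbc.le]
    refine isInterval_arc (by omega) ?_
    obtain ⟨k, hk⟩ := hD
    obtain ⟨u, hu⟩ := ho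
    obtain ⟨v, hv⟩ := ho'
    omega
  · exact Finset.disjoint_left.1 hd m1 (e.1.1 m1)
  · exact Finset.disjoint_left.1 hd (e.1.1 m2) m2

/-- The even positions of a member `I` of `B` are covered by members of `B` that start and end
at even positions of `I`. -/
lemma exists_cover (h : phi D B) (hD : Even D) {a b x : ℤ} (hb : b < a + (D + 1))
    (ho : Odd (b - a)) (hI : arc D a b ∈ B) (hx : a < x) (hxb : x < b) (he : Even (x - a)) :
    ∃ p q : ℤ, a < p ∧ p < x ∧ x ≤ q ∧ q < b ∧ Odd (p - a) ∧ Odd (q - p) ∧ arc D p q ∈ B := by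
  obtain ⟨𝒥, hJB, hJI, hJd, hJc⟩ := h.2.2 _ hI
  have cover : ∀ y : ℤ, a < y → y < b → Even (y - a) →
      ∃ p q : ℤ, a ≤ p ∧ p < y ∧ y ≤ q ∧ q ≤ b ∧ Odd (q - p) ∧ arc D p q ∈ 𝒥 := by
    intro y h1 h2 h3
    have : (y : ZMod (D + 1)) ∈ evSet D (arc D a b) := by
      rw [mem_evSet_arc hb h1 h2.le]
      refine ⟨h3, ?_⟩
      obtain ⟨u, hu⟩ := ho
      obtain ⟨v, hv⟩ := h3
      exact ⟨u - v, by omega⟩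
    obtain ⟨J, hJ, hyJ⟩ := Finset.mem_biUnion.1 (hJc this)
    obtain ⟨p, q, h4, h5, h6, h7, rfl⟩ :=
      (h.1 J (hJB hJ)).exists_arc_of_subset hb (hJI J hJ).1.1
    obtain ⟨t, h8, h9, h10⟩ := mem_arc.1 hyJ
    have := eq_of_cast_eq (a := a) (by omega) (by omega) h1 (by omega) h10
    exact ⟨p, q, h4, by omega, by omega, h6, h7, hJ⟩
  obtain ⟨p, q, h1, h2, h3, h4, h5, h6⟩ := cover x hx hxb he
  have adj : ∀ p q r : ℤ, p < q → q < r → r ≤ p + (D + 1) → Odd (q - p) → Odd (r - q) →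
      arc D p q ∈ 𝒥 → arc D q r ∈ 𝒥 → False := fun p q r h1 h2 h3 h4 h5 h6 h7 =>
    h.not_adjacent hD h1 h2 h3 h4 h5 (hJB h6) (hJB h7)
  have hpo : Odd (p - a) := by
    by_contra hpe
    rw [Int.not_odd_iff_even] at hpe
    rcases lt_or_ge q b with hqb | hqb
    · have hq1 : q + 1 < b := by
        obtain ⟨u, hu⟩ := ho
        obtain ⟨v, hv⟩ := hpe
        obtain ⟨w, hw⟩ := h5
        omega
      obtain ⟨r, s, g1, g2, g3, g4, g5, g6⟩ := cover (q + 1) (by omega) hq1 (by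
        have := (hpe.add_odd h5).add_odd odd_one
        rwa [show p - a + (q - p) + 1 = q + 1 - a by ring] at this)
      have hne : arc D p q ≠ arc D r s := by
        intro e
        have : ((q + 1 : ℤ) : ZMod (D + 1)) ∈ arc D p q := by
          rw [e]
          exact mem_arc.2 ⟨q + 1, g2, g3, rfl⟩
        rw [cast_mem_arc (by omega) (by omega) (by omega)] at this
        omega
      have hdis := hJd _ h6 _ g6 hne
      have hrq : r = q := by
        by_contra hrq
        exact Finset.disjoint_left.1 hdis (mem_arc.2 ⟨q, by omega, le_rfl, rfl⟩)
          (mem_arc.2 ⟨q, by omega, by omega, rfl⟩)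
      subst hrq
      exact adj _ _ _ (by omega) (by omega) (by omega) h5 g5 h6 g6
    · obtain rfl : q = b := by omega
      have hap : a < p := by
        rcases h1.eq_or_lt with rfl | h1
        · exact absurd rfl (hJI _ h6).1.ne
        · exact h1
      obtain ⟨r, s, g1, g2, g3, g4, g5, g6⟩ := cover p hap (by omega) hpe
      have hne : arc D r s ≠ arc D p q := by
        intro e
        have : (p : ZMod (D + 1)) ∈ arc D p q := by
          rw [← e]
          exact mem_arc.2 ⟨p, g2, g3, rfl⟩
        exact cast_left_notMem_arc (by omega) this
      have hdis := hJd _ g6 _ h6 hne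
      have hsp : s = p := by
        by_contra hsp
        exact Finset.disjoint_left.1 hdis (mem_arc.2 ⟨p + 1, by omega, by omega, rfl⟩)
          (mem_arc.2 ⟨p + 1, by omega, by omega, rfl⟩)
      subst hsp
      exact adj _ _ _ (by omega) (by omega) (by omega) g5 h5 g6 h6
  refine ⟨p, q, ?_, h2, h3, ?_, hpo, h5, hJB h6⟩
  · obtain ⟨u, hu⟩ := hpo
    omega
  · obtain ⟨u, hu⟩ := hpo
    obtain ⟨v, hv⟩ := h5
    obtain ⟨w, hw⟩ := ho
    omega

/-- Nested members of `B` share no endpoint. -/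
lemma strict_of_nested (h : phi D B) (hD : Even D) {a b p q : ℤ} (hb : b < a + (D + 1))
    (ho : Odd (b - a)) (hI : arc D a b ∈ B) (hap : a ≤ p) (hpq : p < q) (hqb : q ≤ b)
    (ho' : Odd (q - p)) (hK : arc D p q ∈ B) : (a = p ∧ q = b) ∨ (a < p ∧ q < b) := by
  have mem : ∀ {r s x : ℤ}, r < x → x ≤ s → (x : ZMod (D + 1)) ∈ arc D r s :=
    fun h1 h2 => mem_arc.2 ⟨_, h1, h2, rfl⟩
  have notMem : ∀ {r s x : ℤ}, a ≤ r → s ≤ b → a < x → x ≤ b → (x ≤ r ∨ s < x) →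
      (x : ZMod (D + 1)) ∉ arc D r s := by
    intro r s x h1 h2 h3 h4 h5 h6
    obtain ⟨y, h7, h8, h9⟩ := mem_arc.1 h6
    have := eq_of_cast_eq (a := a) (by omega) (by omega) h3 (by omega) h9
    omega
  rcases hap.eq_or_lt with rfl | hap <;> rcases hqb.eq_or_lt with rfl | hqb
  · exact Or.inl ⟨rfl, rfl⟩
  · exfalso
    obtain ⟨r, s, g1, g2, g3, g4, g5, g6, g7⟩ := h.exists_cover hD (x := q + 1) hb ho hI
      (by omega) (by obtain ⟨u, hu⟩ := ho; obtain ⟨v, hv⟩ := ho'; omega)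
      (by obtain ⟨v, hv⟩ := ho'; exact ⟨v + 1, by omega⟩)
    rcases h.2.1 _ hK _ g7 with e | e | e | e
    · exact notMem (x := q + 1) le_rfl (by omega) (by omega) (by omega) (by omega)
        (e ▸ mem g2 g3)
    · have hrq : r = q := by
        by_contra hrq
        exact Finset.disjoint_left.1 (Finset.disjoint_iff_inter_eq_empty.2 e.1)
          (mem (x := q) (by omega) le_rfl) (mem (by omega) (by omega))
      subst hrq
      exact h.not_adjacent hD hpq (by omega) (by omega) ho' g6 hK g7
    · exact notMem (x := a + 1) (by omega) (by omega) (by omega) (by omega) (by omega)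
        (e.1.1 (mem (x := a + 1) (by omega) (by omega)))
    · exact notMem (x := q + 1) le_rfl (by omega) (by omega) (by omega) (by omega)
        (e.1.1 (mem g2 g3))
  · exfalso
    obtain ⟨r, s, g1, g2, g3, g4, g5, g6, g7⟩ := h.exists_cover hD (x := p) hb ho hI
      (by omega) (by omega)
      (by obtain ⟨u, hu⟩ := ho; obtain ⟨v, hv⟩ := ho'; exact ⟨u - v, by omega⟩)
    rcases h.2.1 _ hK _ g7 with e | e | e | e
    · exact notMem (x := p) hap.le (by omega) (by omega) (by omega) (by omega)
        (e ▸ mem g2 g3)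
    · have hsp : s = p := by
        by_contra hsp
        exact Finset.disjoint_left.1 (Finset.disjoint_iff_inter_eq_empty.2 e.1)
          (mem (x := p + 1) (by omega) (by omega)) (mem (by omega) (by omega))
      subst hsp
      exact h.not_adjacent hD g2 (by omega) (by omega) g6 ho' g7 hK
    · exact notMem (x := q) (by omega) (by omega) (by omega) (by omega) (by omega)
        (e.1.1 (mem (x := q) (by omega) (by omega)))
    · exact notMem (x := p) hap.le (by omega) (by omega) (by omega) (by omega)
        (e.1.1 (mem g2 g3))
  · exact Or.inr ⟨hap, hqb⟩

/-- Every point strictly between the endpoints of a member of `B` is an endpoint of a smaller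
member. -/
lemma exists_endpoint (h : phi D B) (hD : Even D) {a b x : ℤ} (hb : b < a + (D + 1))
    (ho : Odd (b - a)) (hI : arc D a b ∈ B) (hx : a < x) (hxb : x < b) :
    ∃ p q : ℤ, a < p ∧ p < q ∧ q < b ∧ Odd (q - p) ∧ arc D p q ∈ B ∧ (x = p ∨ x = q) := by
  obtain ⟨n, hn⟩ : ∃ n : ℕ, n = (b - a).toNat := ⟨_, rfl⟩
  induction n using Nat.strong_induction_on generalizing a b with
  | _ n ih =>
    have step : ∀ p q : ℤ, a < p → p ≤ x → x ≤ q → p < q → q < b → Odd (q - p) →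
        arc D p q ∈ B →
        ∃ p q : ℤ, a < p ∧ p < q ∧ q < b ∧ Odd (q - p) ∧ arc D p q ∈ B ∧ (x = p ∨ x = q) := by
      intro p q h1 h2 h3 h4 h5 h6 h7
      rcases h2.eq_or_lt with h2 | h2
      · exact ⟨p, q, h1, h4, h5, h6, h7, Or.inl h2.symm⟩
      rcases h3.eq_or_lt with h3 | h3
      · exact ⟨p, q, h1, h4, h5, h6, h7, Or.inr h3⟩
      obtain ⟨r, s, g1, g2, g3, g4⟩ := ih (q - p).toNat (by omega) (by omega) h6 h7 h2 h3 rfl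
      exact ⟨r, s, by omega, g2, by omega, g4⟩
    rcases Int.even_or_odd (x - a) with he | he
    · obtain ⟨p, q, h1, h2, h3, h4, -, h6, h7⟩ := h.exists_cover hD hb ho hI hx hxb he
      exact step p q h1 h2.le h3 (by omega) h4 h6 h7
    · obtain ⟨p, q, h1, h2, h3, h4, -, h6, h7⟩ := h.exists_cover hD (x := x + 1) hb ho hI
        (by omega) (by obtain ⟨u, hu⟩ := ho; obtain ⟨v, hv⟩ := he; omega)
        (by obtain ⟨v, hv⟩ := he; exact ⟨v + 1, by omega⟩)
      exact step p q h1 (by omega) (by omega) (by omega) h4 h6 h7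

/-- Members of `B` with the same right end are equal. -/
lemma left_eq_of_right_eq (h : phi D B) (hD : Even D) {a p b : ℤ} (hab : a < b) (hpb : p < b)
    (ha : b < a + (D + 1)) (hp : b < p + (D + 1)) (ho : Odd (b - a)) (ho' : Odd (b - p))
    (h1 : arc D a b ∈ B) (h2 : arc D p b ∈ B) : a = p := by
  rcases le_total a p with hap | hap
  · have := h.strict_of_nested hD ha ho h1 hap hpb le_rfl ho' h2
    omega
  · have := h.strict_of_nested hD hp ho' h2 hap hab le_rfl ho h1
    omega

/-- Members of `B` with the same left end are equal. -/
lemma right_eq_of_left_eq (h : phi D B) (hD : Even D) {a b q : ℤ} (hab : a < b) (haq : a < q)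
    (hb : b < a + (D + 1)) (hq : q < a + (D + 1)) (ho : Odd (b - a)) (ho' : Odd (q - a))
    (h1 : arc D a b ∈ B) (h2 : arc D a q ∈ B) : b = q := by
  rcases le_total b q with hbq | hbq
  · have := h.strict_of_nested hD hq ho' h2 le_rfl hab hbq ho h1
    omega
  · have := h.strict_of_nested hD hb ho h1 le_rfl haq hbq ho' h2
    omega

/-- The right end of a member of `B` is not the left end of a member of `B`. -/
lemma right_ne_left (h : phi D B) (hD : Even D) {a b c : ℤ} (hab : a < b) (hbc : b < c)
    (hb : b < a + (D + 1)) (hc : c < b + (D + 1)) (ho : Odd (b - a)) (ho' : Odd (c - b))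
    (h1 : arc D a b ∈ B) (h2 : arc D b c ∈ B) : False := by
  rcases le_or_gt c (a + (D + 1)) with hca | hca
  · exact h.not_adjacent hD hab hbc hca ho ho' h1 h2
  · have mb : (b : ZMod (D + 1)) ∈ arc D a b := mem_arc.2 ⟨b, hab, le_rfl, rfl⟩
    have mb' : (b : ZMod (D + 1)) ∉ arc D b c := cast_left_notMem_arc hc
    have mb1 : ((b + 1 : ℤ) : ZMod (D + 1)) ∈ arc D b c := mem_arc.2 ⟨b + 1, by omega, hbc, rfl⟩
    have mb1' : ((b + 1 : ℤ) : ZMod (D + 1)) ∉ arc D a b := by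
      rw [cast_mem_arc hb.le (by omega) (by omega)]
      omega
    rcases h.2.1 _ h1 _ h2 with e | e | e | e
    · exact mb' (e ▸ mb)
    · have : ((a + 1 : ℤ) : ZMod (D + 1)) ∈ arc D a b ∩ arc D b c := by
        refine Finset.mem_inter.2 ⟨mem_arc.2 ⟨a + 1, by omega, by omega, rfl⟩, ?_⟩
        rw [← cast_add_period]
        exact mem_arc.2 ⟨_, by omega, by omega, rfl⟩
      rw [e.1] at this
      simp at this
    · exact mb' (e.1.1 mb)
    · exact mb1' (e.1.1 mb1)

end phi

/-- The set of right ends of the members of `B`. -/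
def rightEnds (D : ℕ) (B : Finset (Finset (ZMod (D + 1)))) : Finset (ZMod (D + 1)) :=
  B.biUnion fun I => I.filter fun x => x + 1 ∉ I

/-- The set of left ends of the members of `B`: an arc `{a + 1, …, b}` has left end `a`. -/
def leftEnds (D : ℕ) (B : Finset (Finset (ZMod (D + 1)))) : Finset (ZMod (D + 1)) :=
  B.biUnion fun I => Finset.univ.filter fun x => x ∉ I ∧ x + 1 ∈ I

namespace phi

variable {D : ℕ} {B C : Finset (Finset (ZMod (D + 1)))}

lemma mem_rightEnds (h : phi D B) {b : ℤ} : (b : ZMod (D + 1)) ∈ rightEnds D B ↔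
    ∃ a : ℤ, a < b ∧ b < a + (D + 1) ∧ Odd (b - a) ∧ arc D a b ∈ B := by
  simp only [rightEnds, Finset.mem_biUnion, Finset.mem_filter]
  constructor
  · rintro ⟨I, hI, h1, h2⟩
    obtain ⟨p, q, hpq, hq, ho, rfl⟩ := (h.1 I hI).exists_arc
    obtain ⟨y, hy, hyq, e⟩ := mem_arc.1 h1
    obtain rfl : y = q := by
      by_contra hne
      refine h2 (mem_arc.2 ⟨y + 1, by omega, by omega, ?_⟩)
      push_cast
      rw [e]
    obtain ⟨k, rfl⟩ := exists_eq_add_mul e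
    exact ⟨p + k * (D + 1), by linarith, by linarith,
      by rwa [show y + k * ((D : ℤ) + 1) - (p + k * (D + 1)) = y - p by ring],
      by rwa [arc_add_mul]⟩
  · rintro ⟨a, h1, h2, h3, h4⟩
    refine ⟨_, h4, mem_arc.2 ⟨b, h1, le_rfl, rfl⟩, ?_⟩
    rw [show (b : ZMod (D + 1)) + 1 = ((b + 1 : ℤ) : ZMod (D + 1)) by push_cast; rfl,
      cast_mem_arc h2.le (by omega) (by omega)]
    omega

lemma mem_leftEnds (h : phi D B) {a : ℤ} : (a : ZMod (D + 1)) ∈ leftEnds D B ↔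
    ∃ b : ℤ, a < b ∧ b < a + (D + 1) ∧ Odd (b - a) ∧ arc D a b ∈ B := by
  simp only [leftEnds, Finset.mem_biUnion, Finset.mem_filter, Finset.mem_univ, true_and]
  constructor
  · rintro ⟨I, hI, h1, h2⟩
    obtain ⟨p, q, hpq, hq, ho, rfl⟩ := (h.1 I hI).exists_arc
    obtain ⟨y, hy, hyq, e⟩ := mem_arc.1 h2
    have e' : ((y - 1 : ℤ) : ZMod (D + 1)) = a := by
      push_cast
      rw [e]
      ring
    obtain rfl : y - 1 = p := by
      by_contra hne
      exact h1 (mem_arc.2 ⟨y - 1, by omega, by omega, e'⟩)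
    obtain ⟨k, rfl⟩ := exists_eq_add_mul e'
    exact ⟨q + k * (D + 1), by linarith, by linarith,
      by rwa [show q + k * ((D : ℤ) + 1) - (y - 1 + k * (D + 1)) = q - (y - 1) by ring],
      by rwa [arc_add_mul]⟩
  · rintro ⟨b, h1, h2, h3, h4⟩
    refine ⟨_, h4, cast_left_notMem_arc h2, mem_arc.2 ⟨a + 1, by omega, by omega, ?_⟩⟩
    push_cast
    rfl

lemma disjoint_ends (h : phi D B) (hD : Even D) : Disjoint (rightEnds D B) (leftEnds D B) := by
  rw [Finset.disjoint_left]
  intro z h1 h2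
  obtain ⟨b, rfl⟩ := ZMod.intCast_surjective z
  obtain ⟨a, a1, a2, a3, a4⟩ := h.mem_rightEnds.1 h1
  obtain ⟨c, c1, c2, c3, c4⟩ := h.mem_leftEnds.1 h2
  exact h.right_ne_left hD a1 c1 a2 c2 a3 c3 a4 c4

lemma card_rightEnds_le (h : phi D B) (hD : Even D) :
    (rightEnds D B).card ≤ (leftEnds D B).card := by
  have key : ∀ z ∈ rightEnds D B, ∃ w ∈ leftEnds D B, ∃ a b : ℤ, a < b ∧ b < a + (D + 1) ∧
      Odd (b - a) ∧ arc D a b ∈ B ∧ (a : ZMod (D + 1)) = w ∧ (b : ZMod (D + 1)) = z := by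
    intro z hz
    obtain ⟨b, rfl⟩ := ZMod.intCast_surjective z
    obtain ⟨a, a1, a2, a3, a4⟩ := h.mem_rightEnds.1 hz
    exact ⟨a, h.mem_leftEnds.2 ⟨b, a1, a2, a3, a4⟩, a, b, a1, a2, a3, a4, rfl, rfl⟩
  choose! f hf hf' using key
  refine Finset.card_le_card_of_injOn f hf ?_
  intro z hz w hw e
  obtain ⟨a, b, a1, a2, a3, a4, a5, rfl⟩ := hf' z hz
  obtain ⟨c, d, c1, c2, c3, c4, c5, rfl⟩ := hf' w hw
  obtain ⟨k, rfl⟩ := exists_eq_add_mul (a5.trans (e.trans c5.symm))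
  have : b = d - k * (D + 1) := by
    refine h.right_eq_of_left_eq hD a1 (by linarith) a2 (by linarith) a3 ?_ a4 ?_
    · rwa [show d - k * ((D : ℤ) + 1) - a = d - (a + k * (D + 1)) by ring]
    · rw [← arc_add_mul D a _ k]
      simpa using c4
  rw [this, ← cast_add_mul D _ k, sub_add_cancel]

lemma two_mul_card_rightEnds_le (h : phi D B) (hD : Even D) : 2 * (rightEnds D B).card ≤ D := by
  have h1 := h.card_rightEnds_le hD
  have h2 := Finset.card_union_of_disjoint (h.disjoint_ends hD)
  have h3 := Finset.card_le_univ (rightEnds D B ∪ leftEnds D B)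
  rw [ZMod.card] at h3
  obtain ⟨k, hk⟩ := hD
  omega

lemma subset_of_rightEnds_eq (hB : phi D B) (hC : phi D C) (hD : Even D)
    (e : rightEnds D B = rightEnds D C) : B ⊆ C := by
  suffices key : ∀ n : ℕ, ∀ a b : ℤ, n = (b - a).toNat → a < b → b < a + (D + 1) →
      Odd (b - a) → arc D a b ∈ B → arc D a b ∈ C by
    intro I hI
    obtain ⟨a, b, h1, h2, h3, rfl⟩ := (hB.1 I hI).exists_arc
    exact key _ a b rfl h1 h2 h3 hI
  intro n
  induction n using Nat.strong_induction_on with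
  | _ n ih =>
    rintro a b hn hab hb ho hI
    have hbC : (b : ZMod (D + 1)) ∈ rightEnds D C := by
      rw [← e, hB.mem_rightEnds]
      exact ⟨a, hab, hb, ho, hI⟩
    obtain ⟨a', h1, h2, h3, h4⟩ := hC.mem_rightEnds.1 hbC
    rcases lt_trichotomy a a' with h | rfl | h
    · exfalso
      obtain ⟨p, q, g1, g2, g3, g4, g5, rfl | rfl⟩ := hB.exists_endpoint hD hb ho hI h h1
      · have hc := ih _ (by omega) a' q rfl g2 (by omega) g4 g5
        have := hC.right_eq_of_left_eq hD h1 g2 h2 (by omega) h3 g4 h4 hc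
        omega
      · have : (a' : ZMod (D + 1)) ∈ rightEnds D C := by
          rw [← e, hB.mem_rightEnds]
          exact ⟨p, g2, by omega, g4, g5⟩
        exact Finset.disjoint_left.1 (hC.disjoint_ends hD) this
          (hC.mem_leftEnds.2 ⟨b, h1, h2, h3, h4⟩)
    · exact h4
    · exfalso
      obtain ⟨p, q, g1, g2, g3, g4, g5, rfl | rfl⟩ := hC.exists_endpoint hD h2 h3 h4 h hab
      · have hq : (q : ZMod (D + 1)) ∈ rightEnds D B := by
          rw [e, hC.mem_rightEnds]
          exact ⟨a, g2, by omega, g4, g5⟩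
        obtain ⟨r, s, k1, k2, k3, k4, k5, rfl | rfl⟩ :=
          hB.exists_endpoint hD hb ho hI g2 g3
        · exact Finset.disjoint_left.1 (hB.disjoint_ends hD) hq
            (hB.mem_leftEnds.2 ⟨s, k2, by omega, k4, k5⟩)
        · have hc := ih _ (by omega) r q rfl k2 (by omega) k4 k5
          have := hC.left_eq_of_right_eq hD g2 k2 (by omega) (by omega) g4 k4 g5 hc
          omega
      · have : (a : ZMod (D + 1)) ∈ rightEnds D B := by
          rw [e, hC.mem_rightEnds]
          exact ⟨p, g2, by omega, g4, g5⟩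
        exact Finset.disjoint_left.1 (hB.disjoint_ends hD) this
          (hB.mem_leftEnds.2 ⟨b, hab, hb, ho, hI⟩)

end phi

lemma mk_indicator_injective {D : ℕ} {s t : Finset (ZMod (D + 1))} (hs : 2 * s.card ≤ D)
    (ht : 2 * t.card ≤ D)
    (h : (Submodule.Quotient.mk (fun x => if x ∈ s then 1 else 0) : Vsp D) =
      Submodule.Quotient.mk (fun x => if x ∈ t then 1 else 0)) : s = t := by
  rw [Submodule.Quotient.eq, Submodule.mem_span_singleton] at h
  obtain ⟨c, hc⟩ := h
  have hc' : ∀ x, c = (if x ∈ s then 1 else 0) - (if x ∈ t then 1 else 0) := by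
    intro x
    simpa [allOnes] using congrFun hc x
  clear hc
  obtain rfl | rfl : c = 0 ∨ c = 1 := (by decide : ∀ c : ZMod 2, c = 0 ∨ c = 1) c
  · ext x
    have := hc' x
    by_cases h1 : x ∈ s <;> by_cases h2 : x ∈ t <;> revert this <;> simp [h1, h2]
  · exfalso
    have hu : s ∪ t = Finset.univ := by
      ext x
      have := hc' x
      by_cases h1 : x ∈ s <;> by_cases h2 : x ∈ t <;> revert this <;> simp [h1, h2]
    have h1 := Finset.card_union_le s t
    rw [hu, Finset.card_univ, ZMod.card] at h1
    omega

/-- `φ(V_D)` has at most as many elements as `V_D`. -/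
lemma card_phi_le {D : ℕ} (hD : Even D) :
    Nat.card {B : Finset (Finset (ZMod (D + 1))) // phi D B} ≤ Nat.card (Vsp D) := by
  refine Nat.card_le_card_of_injective (fun B => (Submodule.Quotient.mk
    (fun x => if x ∈ rightEnds D B.1 then 1 else 0) : Vsp D)) ?_
  rintro ⟨B, hB⟩ ⟨C, hC⟩ h
  have e := mk_indicator_injective (hB.two_mul_card_rightEnds_le hD)
    (hC.two_mul_card_rightEnds_le hD) h
  exact Subtype.ext ((hB.subset_of_rightEnds_eq hC hD e).antisymm
    (hC.subset_of_rightEnds_eq hB hD e.symm))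

/-! ### Cyclic words -/

section CyclicWords

variable {Q : List (ZMod 2) → Prop}

lemma exists_adjacent_eq_or_getLast_eq (u : List (ZMod 2)) (a : ZMod 2) :
    (∃ s c s', a :: u = s ++ c :: c :: s') ∨
      (a :: u).getLast (List.cons_ne_nil a u) = a + (u.length : ZMod 2) := by
  induction u generalizing a with
  | nil => simp
  | cons b u ih =>
    by_cases hab : a = b
    · exact Or.inl ⟨[], a, u, by simp [hab]⟩
    · rcases ih b with ⟨s, c, s', e⟩ | e
      · exact Or.inl ⟨a :: s, c, s', by rw [e]; rfl⟩
      · right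
        rw [List.getLast_cons (List.cons_ne_nil b u), e, List.length_cons]
        rw [(by decide : ∀ x y : ZMod 2, x ≠ y → y = x + 1) a b hab]
        push_cast
        ring

lemma rotate_append (rot : ∀ x w, Q (w ++ [x]) → Q (x :: w)) (u v : List (ZMod 2))
    (h : Q (v ++ u)) : Q (u ++ v) := by
  induction u generalizing v with
  | nil => simpa using h
  | cons x u ih =>
    refine rot x (u ++ v) ?_
    rw [List.append_assoc]
    refine ih (v ++ [x]) ?_
    simpa using h

lemma flip_append (rot : ∀ x w, Q (w ++ [x]) → Q (x :: w))
    (flip : ∀ a w, Q ((a + 1) :: (a + 1) :: w) → Q (a :: a :: w)) (u v : List (ZMod 2))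
    (a : ZMod 2) (h : Q (u ++ (a + 1) :: (a + 1) :: v)) : Q (u ++ a :: a :: v) := by
  refine rotate_append rot u (a :: a :: v) (flip a (v ++ u) ?_)
  exact rotate_append rot ((a + 1) :: (a + 1) :: v) u h

lemma zeros_append (rot : ∀ x w, Q (w ++ [x]) → Q (x :: w))
    (flip : ∀ a w, Q ((a + 1) :: (a + 1) :: w) → Q (a :: a :: w)) (u v : List (ZMod 2))
    (a : ZMod 2) (h : Q (u ++ 0 :: 0 :: v)) : Q (u ++ a :: a :: v) := by
  obtain rfl | rfl := (by decide : ∀ c : ZMod 2, c = 0 ∨ c = 1) a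
  · exact h
  · exact flip_append rot flip u v 1 h

lemma move_zeros (rot : ∀ x w, Q (w ++ [x]) → Q (x :: w))
    (flip : ∀ a w, Q ((a + 1) :: (a + 1) :: w) → Q (a :: a :: w)) (s u v : List (ZMod 2))
    (h : Q (s ++ 0 :: 0 :: (u ++ v))) : Q (s ++ u ++ 0 :: 0 :: v) := by
  induction u generalizing s with
  | nil => simpa using h
  | cons c u ih =>
    have := ih (s ++ [c]) (by
      obtain rfl | rfl := (by decide : ∀ c : ZMod 2, c = 0 ∨ c = 1) c
      · simpa using h
      · have h1 : Q ((s ++ [1]) ++ 1 :: 1 :: (u ++ v)) := by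
          have := flip_append rot flip s (1 :: (u ++ v)) 1 (by
            rw [show (1 : ZMod 2) + 1 = 0 from rfl]
            simpa using h)
          simpa using this
        exact flip_append rot flip (s ++ [1]) (u ++ v) 0 (by simpa using h1))
    simpa using this

lemma move_zeros_replicate (rot : ∀ x w, Q (w ++ [x]) → Q (x :: w))
    (flip : ∀ a w, Q ((a + 1) :: (a + 1) :: w) → Q (a :: a :: w)) (m : ℕ) (a : ZMod 2)
    (s w : List (ZMod 2)) (h : Q (s ++ (List.replicate (2 * m) 0 ++ a :: w))) :
    Q (s ++ a :: (List.replicate (2 * m) 0 ++ w)) := by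
  induction m generalizing s with
  | zero => simpa using h
  | succ m ih =>
    have h1 := ih (s ++ [0, 0]) (by simpa [mul_add, List.replicate_succ] using h)
    have h2 := move_zeros rot flip s [a] (List.replicate (2 * m) 0 ++ w) (by simpa using h1)
    simpa [mul_add, List.replicate_succ] using h2

/-- A cyclic word in `0, 1` of odd length and even weight can be reduced to the zero word by
exchanging adjacent letters `00` and `11`. -/
lemma cyclic_word_reduction (rot : ∀ x w, Q (w ++ [x]) → Q (x :: w))
    (flip : ∀ a w, Q ((a + 1) :: (a + 1) :: w) → Q (a :: a :: w))
    (zero : ∀ m, Q (List.replicate m 0)) (w : List (ZMod 2)) (hw : Odd w.length)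
    (hs : w.sum = 0) : Q w := by
  suffices key : ∀ n, ∀ v : List (ZMod 2), v.length = n → Odd v.length → v.sum = 0 →
      ∀ m, Q (List.replicate (2 * m) 0 ++ v) by
    simpa using key _ w rfl hw hs 0
  intro n
  induction n using Nat.strong_induction_on with
  | _ n ih =>
    intro v hn ho hv m
    have adj : ∀ s c s', v.length = (s ++ c :: c :: s').length → v.sum = (s ++ c :: c :: s').sum →
        Q (List.replicate (2 * m) 0 ++ (s ++ c :: c :: s')) := by
      intro s c s' hl hsum
      rw [← List.append_assoc]
      refine zeros_append rot flip _ s' c ?_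
      refine move_zeros rot flip _ s s' ?_
      have hc : c + c = 0 := (by decide : ∀ c : ZMod 2, c + c = 0) c
      have := ih (s ++ s').length (by simp at hl ⊢; omega) (s ++ s') rfl
        (by obtain ⟨k, hk⟩ := ho; simp at hl ⊢; exact ⟨k - 1, by omega⟩)
        (by
          rw [← hv, hsum]
          simp only [List.sum_append, List.sum_cons]
          linear_combination -hc) (m + 1)
      rwa [mul_add, List.replicate_add, List.append_assoc] at this
    cases v with
    | nil => simp at ho
    | cons a u =>
      rcases exists_adjacent_eq_or_getLast_eq u a with ⟨s, c, s', e⟩ | e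
      · rw [e]
        exact adj s c s' (by rw [e]) (by rw [e])
      · have hu : (u.length : ZMod 2) = 0 := by
          rw [ZMod.natCast_eq_zero_iff_even]
          rw [List.length_cons] at ho
          exact (Nat.odd_add_one.1 ho |> Nat.not_odd_iff_even.1)
        rw [hu, add_zero] at e
        rcases List.eq_nil_or_concat u with rfl | ⟨u, b, rfl⟩
        · have ha : a = 0 := by simpa using hv
          rw [ha, ← List.replicate_one, ← List.replicate_add]
          exact zero _
        · obtain rfl : b = a := by simpa using e
          have h1 := adj [] b u (by simp) (by simp [add_comm])
          have h2 := move_zeros_replicate rot flip m b [] (b :: u) (by simpa using h1)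
          have h3 := rotate_append rot (List.replicate (2 * m) 0 ++ b :: u) [b] h2
          simpa using h3

end CyclicWords

/-! ### Periodic noncrossing matchings -/

/-- The gap between `t` and `t'` has odd length, and its even positions are covered by the pairs
of `M` inside the gap. -/
def Gap (M : ℤ → ℤ → Prop) (t t' : ℤ) : Prop :=
  t < t' ∧ Odd (t' - t) ∧ ∀ x, t < x → x < t' → Even (x - t) →
    ∃ p q, M p q ∧ t < p ∧ p < x ∧ x ≤ q ∧ q < t'

lemma Gap.mono {M M' : ℤ → ℤ → Prop} (hM : ∀ p q, M p q → M' p q) {t t' : ℤ} (h : Gap M t t') :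
    Gap M' t t' := by
  refine ⟨h.1, h.2.1, fun x h1 h2 h3 => ?_⟩
  obtain ⟨p, q, k⟩ := h.2.2 x h1 h2 h3
  exact ⟨p, q, hM p q k.1, k.2⟩

lemma Gap.add_period {M : ℤ → ℤ → Prop} {n : ℤ} (hM : ∀ p q, M p q → M (p + n) (q + n))
    {t t' : ℤ} (h : Gap M t t') : Gap M (t + n) (t' + n) := by
  refine ⟨by linarith [h.1], by simpa using h.2.1, fun x g1 g2 g3 => ?_⟩
  obtain ⟨p, q, k1, k2, k3, k4, k5⟩ := h.2.2 (x - n) (by omega) (by omega) (by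
    rwa [show x - n - t = x - (t + n) by ring])
  exact ⟨_, _, hM p q k1, by omega, by omega, by omega, by omega⟩

/-- Three consecutive gaps merge into one when the two points between them are matched. -/
lemma Gap.merge {M : ℤ → ℤ → Prop} {t a b t' : ℤ} (h1 : Gap M t a) (h2 : Gap M a b)
    (h3 : Gap M b t') (hM : M a b) : Gap M t t' := by
  obtain ⟨l1, ⟨u, hu⟩, c1⟩ := h1
  obtain ⟨l2, ⟨v, hv⟩, c2⟩ := h2
  obtain ⟨l3, ⟨w, hw⟩, c3⟩ := h3
  refine ⟨by omega, ⟨u + v + w + 1, by omega⟩, fun x g1 g2 ⟨y, hy⟩ => ?_⟩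
  rcases lt_or_ge x a with hxa | hxa
  · obtain ⟨p, q, k1, k2, k3, k4, k5⟩ := c1 x g1 hxa ⟨y, hy⟩
    exact ⟨p, q, k1, by omega, by omega, by omega, by omega⟩
  · rcases le_or_gt x b with hxb | hxb
    · exact ⟨a, b, hM, by omega, by omega, hxb, by omega⟩
    · obtain ⟨p, q, k1, k2, k3, k4, k5⟩ := c3 x hxb g2 ⟨y - u - v - 1, by omega⟩
      exact ⟨p, q, k1, by omega, by omega, by omega, by omega⟩

/-- A noncrossing matching `M` of part of the cycle, lifted to a periodic relation on `ℤ`, with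
set of arcs `B`; the points of `a :: l` are the unmatched ones, in cyclic order. -/
structure MatchingState (D : ℕ) (a : ℤ) (l : List ℤ) (M : ℤ → ℤ → Prop)
    (B : Finset (Finset (ZMod (D + 1)))) : Prop where
  periodic : ∀ p q, M p q → ∀ k : ℤ, M (p + k * (D + 1)) (q + k * (D + 1))
  mem : ∀ I, I ∈ B ↔ ∃ p q, M p q ∧ I = arc D p q
  lt : ∀ p q, M p q → p < q ∧ q < p + (D + 1) ∧ Odd (q - p)
  nested : ∀ p q p' q', M p q → M p' q' → (p = p' ∧ q = q') ∨ q < p' ∨ q' < p ∨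
    (p < p' ∧ q' < q) ∨ (p' < p ∧ q < q')
  cover : ∀ p q x, M p q → p < x → x < q → Even (x - p) →
    ∃ p' q', M p' q' ∧ p < p' ∧ p' < x ∧ x ≤ q' ∧ q' < q
  chain : (a :: (l ++ [a + (D + 1)])).IsChain (Gap M)
  avoid : ∀ p q, M p q → ∀ t ∈ a :: l, ∀ k : ℤ,
    ¬ (p ≤ t + k * (D + 1) ∧ t + k * (D + 1) ≤ q)

namespace MatchingState

variable {D : ℕ} {a b c : ℤ} {l : List ℤ} {M : ℤ → ℤ → Prop}
  {B : Finset (Finset (ZMod (D + 1)))}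

lemma pairwise (h : MatchingState D a l M B) : (a :: (l ++ [a + (D + 1)])).Pairwise (· < ·) :=
  (h.chain.imp fun _ _ g => g.1).pairwise

lemma lt_of_mem (h : MatchingState D a l M B) {t : ℤ} (ht : t ∈ l) : a < t ∧ t < a + (D + 1) := by
  have := h.pairwise
  rw [List.pairwise_cons, List.pairwise_append] at this
  exact ⟨this.1 t (by simp [ht]), this.2.2.2 t ht _ (by simp)⟩

lemma trichotomy (h : MatchingState D a l M B) {I J : Finset (ZMod (D + 1))} (hI : I ∈ B)
    (hJ : J ∈ B) : I = J ∨ Spade D I J ∨ Prec D I J ∨ Prec D J I := by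
  obtain ⟨p, q, hpq, rfl⟩ := (h.mem I).1 hI
  obtain ⟨r, s, hrs, rfl⟩ := (h.mem J).1 hJ
  obtain ⟨r', g1, g2, g3⟩ := exists_lift (D := D) (p - 1) (r : ZMod (D + 1))
  obtain ⟨k, hk⟩ := exists_eq_add_mul g3.symm
  have hM := h.periodic r s hrs k
  rw [← arc_add_mul D r s k]
  rw [← hk] at hM ⊢
  generalize s + k * ((D : ℤ) + 1) = s' at hM
  have l1 := h.lt _ _ hpq
  have l2 := h.lt _ _ hM
  have hM' : M (p + (D + 1)) (q + (D + 1)) := by simpa using h.periodic p q hpq 1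
  rcases h.nested _ _ _ _ hpq hM with e | e | e | e | e
  · exact Or.inl (by rw [e.1, e.2])
  · rcases h.nested _ _ _ _ hM' hM with e' | e' | e' | e' | e'
    · omega
    · omega
    · exact Or.inr (Or.inl (spade_arc l1.1 e l2.1 e'))
    · omega
    · rw [← arc_add_period D p q]
      exact Or.inr (Or.inr (Or.inl (prec_arc e'.1 (by omega) e'.2 l2.2.1)))
  · omega
  · exact Or.inr (Or.inr (Or.inr (prec_arc e.1 l2.1 e.2 l1.2.1)))
  · omega

lemma phi (h : MatchingState D a l M B) : phi D B := by
  classical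
  refine ⟨?_, fun I hI J hJ => h.trichotomy hI hJ, ?_⟩
  · intro I hI
    obtain ⟨p, q, hpq, rfl⟩ := (h.mem I).1 hI
    obtain ⟨h1, h2, h3⟩ := h.lt p q hpq
    exact oddInterval_arc h1 h2 h3
  · intro I hI
    refine ⟨B.filter fun J => Prec D J I ∧ ∀ K ∈ B, Prec D K I → ¬ J ⊂ K,
      Finset.filter_subset _ _, fun J hJ => (Finset.mem_filter.1 hJ).2.1, ?_, ?_⟩
    · intro J hJ K hK hne
      rw [Finset.mem_filter] at hJ hK
      rcases h.trichotomy hJ.1 hK.1 with e | e | e | e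
      · exact absurd e hne
      · exact Finset.disjoint_iff_inter_eq_empty.2 e.1
      · exact absurd e.1 (hJ.2.2 K hK.1 hK.2.1)
      · exact absurd e.1 (hK.2.2 J hJ.1 hJ.2.1)
    · intro z hz
      obtain ⟨p, q, hpq, rfl⟩ := (h.mem I).1 hI
      have l1 := h.lt p q hpq
      have hzI : z ∈ arc D p q := by
        simp only [evSet, Finset.mem_filter] at hz
        exact hz.1
      obtain ⟨x, hx, hxq, rfl⟩ := mem_arc.1 hzI
      rw [mem_evSet_arc l1.2.1 hx hxq] at hz
      obtain ⟨r, s, hrs, g1, g2, g3, g4⟩ := h.cover p q x hpq hx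
        (by obtain ⟨u, hu⟩ := hz.2; obtain ⟨v, hv⟩ := l1.2.2; obtain ⟨w, hw⟩ := hz.1; omega) hz.1
      obtain ⟨J, hJ, hmax⟩ := Finset.exists_max_image
        (B.filter fun J => Prec D J (arc D p q) ∧ (x : ZMod (D + 1)) ∈ J) Finset.card
        ⟨arc D r s, Finset.mem_filter.2 ⟨(h.mem _).2 ⟨r, s, hrs, rfl⟩,
          prec_arc g1 (by omega) g4 l1.2.1, mem_arc.2 ⟨x, g2, g3, rfl⟩⟩⟩
      rw [Finset.mem_filter] at hJ
      refine Finset.mem_biUnion.2 ⟨J, Finset.mem_filter.2 ⟨hJ.1, hJ.2.1, ?_⟩, hJ.2.2⟩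
      intro K hK hKI hJK
      have := hmax K (Finset.mem_filter.2 ⟨hK, hKI, hJK.1 hJ.2.2⟩)
      exact absurd (Finset.card_lt_card hJK) (by omega)

lemma rotate (h : MatchingState D a (b :: l) M B) :
    MatchingState D b (l ++ [a + (D + 1)]) M B where
  periodic := h.periodic
  mem := h.mem
  lt := h.lt
  nested := h.nested
  cover := h.cover
  chain := by
    have h1 := h.chain
    have hab : Gap M a b := by simpa using h1.rel
    have hab' : Gap M (a + (D + 1)) (b + (D + 1)) :=
      hab.add_period fun p q hpq => by simpa using h.periodic p q hpq 1
    have h2 : (b :: l ++ [a + (D + 1)]).IsChain (Gap M) := by simpa using h1.tail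
    have h3 : ([a + (D + 1)] ++ [b + (D + 1)] : List ℤ).IsChain (Gap M) := by simpa using hab'
    simpa using h2.append_overlap h3 (by simp)
  avoid := by
    intro p q hpq t ht k
    simp only [List.mem_cons, List.mem_append, List.not_mem_nil, or_false] at ht
    have main := fun t ht => h.avoid p q hpq t ht
    rcases ht with rfl | ht | rfl
    · exact main _ (by simp) k
    · exact main _ (by simp [ht]) k
    · have := main a (by simp) (k + 1)
      rwa [show a + (k + 1) * ((D : ℤ) + 1) = a + (D + 1) + k * (D + 1) by ring] at this

lemma cut (h : MatchingState D a (b :: c :: l) M B) :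
    MatchingState D c l (fun p q => M p q ∨ ∃ k : ℤ, p = a + k * (D + 1) ∧ q = b + k * (D + 1))
      (insert (arc D a b) B) where
  periodic := by
    rintro p q (hpq | ⟨j, rfl, rfl⟩) k
    · exact Or.inl (h.periodic p q hpq k)
    · exact Or.inr ⟨j + k, by ring, by ring⟩
  mem := by
    intro I
    rw [Finset.mem_insert, h.mem]
    constructor
    · rintro (rfl | ⟨p, q, hpq, rfl⟩)
      · exact ⟨a, b, Or.inr ⟨0, by simp⟩, rfl⟩
      · exact ⟨p, q, Or.inl hpq, rfl⟩
    · rintro ⟨p, q, hpq | ⟨k, rfl, rfl⟩, rfl⟩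
      · exact Or.inr ⟨p, q, hpq, rfl⟩
      · exact Or.inl (arc_add_mul D a b k)
  lt := by
    rintro p q (hpq | ⟨k, rfl, rfl⟩)
    · exact h.lt p q hpq
    · have h1 := h.lt_of_mem (t := b) (by simp)
      have h2 : Gap M a b := by simpa using h.chain.rel
      exact ⟨by linarith, by linarith, by simpa using h2.2.1⟩
  nested := by
    have hb := h.lt_of_mem (t := b) (by simp)
    have old : ∀ p q k, M p q → (q < a + k * (D + 1) ∨ b + k * (D + 1) < p ∨
        (p < a + k * (D + 1) ∧ b + k * (D + 1) < q) ∨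
        (a + k * (D + 1) < p ∧ q < b + k * (D + 1))) := by
      intro p q k hpq
      have h1 := h.avoid p q hpq a (by simp) k
      have h2 := h.avoid p q hpq b (by simp) k
      have h3 := (h.lt p q hpq).1
      generalize k * ((D : ℤ) + 1) = m at *
      omega
    rintro p q p' q' (hpq | ⟨k, rfl, rfl⟩) (hpq' | ⟨k', rfl, rfl⟩)
    · exact h.nested p q p' q' hpq hpq'
    · have := old p q k' hpq
      omega
    · have := old p' q' k hpq'
      omega
    · have hn : (0 : ℤ) < D + 1 := by positivity
      rcases lt_trichotomy k k' with hk | rfl | hk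
      · have : (k + 1) * ((D : ℤ) + 1) ≤ k' * (D + 1) := mul_le_mul_of_nonneg_right hk hn.le
        right; left
        linarith
      · exact Or.inl ⟨rfl, rfl⟩
      · have : (k' + 1) * ((D : ℤ) + 1) ≤ k * (D + 1) := mul_le_mul_of_nonneg_right hk hn.le
        right; right; left
        linarith
  cover := by
    rintro p q x (hpq | ⟨k, rfl, rfl⟩) h1 h2 h3
    · obtain ⟨r, s, g1, g2⟩ := h.cover p q x hpq h1 h2 h3
      exact ⟨r, s, Or.inl g1, g2⟩
    · have hab : Gap M a b := by simpa using h.chain.rel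
      have hab' := hab.add_period (n := k * (D + 1)) fun p q hpq => h.periodic p q hpq k
      obtain ⟨r, s, g1, g2⟩ := hab'.2.2 x h1 h2 h3
      exact ⟨r, s, Or.inl g1, g2⟩
  chain := by
    set M' : ℤ → ℤ → Prop :=
      fun p q => M p q ∨ ∃ k : ℤ, p = a + k * (D + 1) ∧ q = b + k * (D + 1)
    have h1 : (a :: b :: c :: (l ++ [a + (D + 1)])).IsChain (Gap M') := by
      simpa using h.chain.imp fun _ _ g => g.mono (M' := M') fun _ _ g' => Or.inl g'
    have per : ∀ p q, M' p q → M' (p + (D + 1)) (q + (D + 1)) := by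
      rintro p q (hpq | ⟨k, rfl, rfl⟩)
      · exact Or.inl (by simpa using h.periodic p q hpq 1)
      · exact Or.inr ⟨k + 1, by ring, by ring⟩
    have hab : Gap M' (a + (D + 1)) (b + (D + 1)) := h1.rel.add_period per
    have hbc : Gap M' (b + (D + 1)) (c + (D + 1)) := h1.tail.rel.add_period per
    have hM : M' (a + (D + 1)) (b + (D + 1)) := Or.inr ⟨1, by ring, by ring⟩
    have h2 : (c :: l ++ [a + (D + 1)]).IsChain (Gap M') := by simpa using h1.tail.tail
    rw [List.isChain_append] at h2
    rw [← List.cons_append, List.isChain_append]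
    refine ⟨h2.1, by simp, fun x hx y hy => ?_⟩
    have := h2.2.2 x hx (a + (D + 1)) (by simp)
    obtain rfl : y = c + (D + 1) := by simpa using hy.symm
    exact this.merge hab hbc hM
  avoid := by
    rintro p q (hpq | ⟨j, rfl, rfl⟩) t ht k
    · exact h.avoid p q hpq t (by simp at ht ⊢; tauto) k
    · rintro ⟨h1, h2⟩
      have hbt : b < t := by
        have := h.pairwise
        simp only [List.cons_append, List.pairwise_cons] at this
        exact this.2.1 t (by simp at ht ⊢; tauto)
      have hta := (h.lt_of_mem (t := t) (by simp at ht ⊢; tauto)).2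
      have hn : (0 : ℤ) < D + 1 := by positivity
      rcases lt_or_ge k j with hk | hk
      · have : (k + 1) * ((D : ℤ) + 1) ≤ j * (D + 1) := mul_le_mul_of_nonneg_right hk hn.le
        linarith
      · have : j * ((D : ℤ) + 1) ≤ k * (D + 1) := mul_le_mul_of_nonneg_right hk hn.le
        linarith

/-- The empty matching. -/
lemma empty (D : ℕ) :
    MatchingState D 0 ((List.range D).map fun t : ℕ => (t : ℤ) + 1) (fun _ _ => False) ∅ where
  periodic := by simp
  mem := by simp
  lt := by simp
  nested := by simp
  cover := by simp
  avoid := by simp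
  chain := by
    have e : (0 : ℤ) :: (((List.range D).map fun t : ℕ => (t : ℤ) + 1) ++ [0 + ((D : ℤ) + 1)]) =
        (List.range (D + 2)).map fun t : ℕ => (t : ℤ) := by
      rw [List.range_succ, List.range_succ_eq_map]
      simp [Function.comp_def]
    rw [e, List.isChain_map]
    refine (List.isChain_range_succ _ (D + 1)).2 fun m hm => ⟨by simp, by simp, ?_⟩
    intro x h1 h2
    simp at h2
    omega

end MatchingState

/-! ### The boundary map -/

/-- The boundary map, sending a function `f` modulo constants to `i ↦ f i + f (i + 1)`. -/
noncomputable def bdry (D : ℕ) : Vsp D →ₗ[ZMod 2] Wsp D :=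
  (Submodule.span (ZMod 2) {allOnes D}).liftQ
    (LinearMap.id + LinearMap.funLeft (ZMod 2) (ZMod 2) fun i : ZMod (D + 1) => i + 1) (by
      rw [Submodule.span_le, Set.singleton_subset_iff]
      ext i
      simp [allOnes, LinearMap.funLeft_apply, CharTwo.add_self_eq_zero])

lemma bdry_mk {D : ℕ} (f : Wsp D) (i : ZMod (D + 1)) :
    bdry D (Submodule.Quotient.mk f) i = f i + f (i + 1) := rfl

lemma eq_zero_of_bdry_eq_zero {D : ℕ} {v : Vsp D} (h : bdry D v = 0) : v = 0 := by
  obtain ⟨f, rfl⟩ := Submodule.Quotient.mk_surjective _ v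
  have hf : ∀ i, f (i + 1) = f i := fun i => by
    have := congrFun h i
    rw [bdry_mk, Pi.zero_apply, CharTwo.add_eq_zero] at this
    exact this.symm
  have hn : ∀ n : ℕ, f n = f 0 := by
    intro n
    induction n with
    | zero => simp
    | succ n ih => rw [Nat.cast_succ, hf, ih]
  rw [Submodule.Quotient.mk_eq_zero, Submodule.mem_span_singleton]
  refine ⟨f 0, ?_⟩
  ext i
  rw [← ZMod.natCast_zmod_val i, hn]
  simp [allOnes]

lemma sum_bdry {D : ℕ} (v : Vsp D) : ∑ i, bdry D v i = 0 := by
  obtain ⟨f, rfl⟩ := Submodule.Quotient.mk_surjective _ v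
  simp only [bdry_mk]
  have h : ∑ i, f (i + 1) = ∑ i, f i := Equiv.sum_comp (Equiv.addRight (1 : ZMod (D + 1))) f
  rw [Finset.sum_add_distrib, h]
  exact CharTwo.add_self_eq_zero _

lemma eSet_eq_mk (D : ℕ) (I : Finset (ZMod (D + 1))) :
    eSet D I = Submodule.Quotient.mk fun i => if i ∈ I then 1 else 0 := by
  have h : (fun i => if i ∈ I then 1 else 0 : Wsp D) = ∑ s ∈ I, Pi.single s 1 := by
    ext i
    simp [Finset.sum_apply, Pi.single_apply]
  rw [h, eSet, ← Submodule.mkQ_apply, map_sum]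
  rfl

lemma bdry_eSet_arc {D : ℕ} {p q : ℤ} (hpq : p < q) (hq : q < p + (D + 1)) (z : ZMod (D + 1)) :
    bdry D (eSet D (arc D p q)) z = if z = p ∨ z = q then 1 else 0 := by
  obtain ⟨x, h1, h2, rfl⟩ := exists_lift (p - 1) z
  have hp : (x : ZMod (D + 1)) = p ↔ x = p :=
    ⟨eq_of_cast_eq h1 h2 (by linarith) (by linarith), fun h => by rw [h]⟩
  have hq' : (x : ZMod (D + 1)) = q ↔ x = q :=
    ⟨eq_of_cast_eq h1 h2 (by linarith) (by linarith), fun h => by rw [h]⟩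
  rw [eSet_eq_mk, bdry_mk]
  have e1 : ((x : ZMod (D + 1)) + 1) ∈ arc D p q ↔ x + 1 ≤ q := by
    rw [← cast_mem_arc (a := p) (x := x + 1) (by linarith) (by linarith) (by linarith)]
    push_cast
    rfl
  have e2 : (x : ZMod (D + 1)) ∈ arc D p q ↔ p < x ∧ x ≤ q := by
    rcases eq_or_ne x p with rfl | hne
    · simpa using cast_left_notMem_arc (by linarith)
    · have : p < x := by omega
      rw [cast_mem_arc (by linarith) this (by linarith)]
      simp [this]
  simp only [e1, e2, hp, hq']
  split_ifs <;> first | omega | simp | decide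

/-! ### Indicator functions of cosets -/

/-- The indicator function of the coset of `y` modulo `⟨B⟩`. -/
noncomputable def cosetInd (D : ℕ) (B : Finset (Finset (ZMod (D + 1)))) (y : Vsp D) :
    Vsp D → ℂ :=
  ind D {x | x + y ∈ spanB D B}

lemma eq_zero_or_one (c : ZMod 2) : c = 0 ∨ c = 1 := by
  revert c
  decide

lemma add_self_Vsp {D : ℕ} (x : Vsp D) : x + x = 0 := by
  rw [← two_smul (ZMod 2), show (2 : ZMod 2) = 0 from rfl, zero_smul]

lemma mem_spanB_insert {D : ℕ} {B : Finset (Finset (ZMod (D + 1)))} {I : Finset (ZMod (D + 1))}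
    {x : Vsp D} : x ∈ spanB D (insert I B) ↔ x ∈ spanB D B ∨ x + eSet D I ∈ spanB D B := by
  rw [spanB, Finset.coe_insert, Set.image_insert_eq, Submodule.mem_span_insert]
  constructor
  · rintro ⟨c, z, hz, rfl⟩
    rcases eq_zero_or_one c with rfl | rfl
    · left
      rwa [zero_smul, zero_add]
    · right
      rw [one_smul, add_right_comm, add_self_Vsp, zero_add]
      exact hz
  · rintro (h | h)
    · exact ⟨0, x, h, by simp⟩
    · refine ⟨1, _, h, ?_⟩
      rw [one_smul, add_comm x, ← add_assoc, add_self_Vsp, zero_add]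

lemma cosetInd_insert {D : ℕ} {B : Finset (Finset (ZMod (D + 1)))} {I : Finset (ZMod (D + 1))}
    (hI : eSet D I ∉ spanB D B) (y : Vsp D) :
    cosetInd D (insert I B) y = cosetInd D B y + cosetInd D B (y + eSet D I) := by
  classical
  ext x
  simp only [cosetInd, ind, Pi.add_apply, Set.indicator_apply, Set.mem_ofPred_eq,
    mem_spanB_insert, ← add_assoc, Pi.one_apply]
  have : ¬ (x + y ∈ spanB D B ∧ x + y + eSet D I ∈ spanB D B) := fun h =>
    hI ((Submodule.add_mem_iff_right _ h.1).1 h.2)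
  split_ifs <;> first | tauto | simp

lemma cosetInd_zero {D : ℕ} (B : Finset (Finset (ZMod (D + 1)))) :
    cosetInd D B 0 = ind D (spanB D B) := by
  simp [cosetInd]

lemma cosetInd_empty {D : ℕ} [DecidableEq (Vsp D)] (y : Vsp D) : cosetInd D ∅ y = Pi.single y 1 := by
  have h : ∀ x : Vsp D, x + y = 0 ↔ x = y := fun x => by
    rw [← add_right_cancel_iff (a := y) (b := x), add_self_Vsp]
  ext x
  simp [cosetInd, ind, spanB, Set.indicator_apply, h, Pi.single_apply]

namespace MatchingState

variable {D : ℕ} {a b c : ℤ} {l : List ℤ} {M : ℤ → ℤ → Prop}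
  {B : Finset (Finset (ZMod (D + 1)))}

lemma bdry_eq_zero (h : MatchingState D a l M B) {v : Vsp D} (hv : v ∈ spanB D B) {t : ℤ}
    (ht : t ∈ a :: l) : bdry D v t = 0 := by
  induction hv using Submodule.span_induction with
  | mem x hx =>
    obtain ⟨I, hI, rfl⟩ := hx
    obtain ⟨p, q, hpq, rfl⟩ := (h.mem I).1 hI
    obtain ⟨h1, h2, -⟩ := h.lt p q hpq
    rw [bdry_eSet_arc h1 h2, if_neg]
    rintro (e | e)
    · obtain ⟨k, rfl⟩ := exists_eq_add_mul e
      exact h.avoid _ _ hpq t ht k ⟨le_rfl, h1.le⟩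
    · obtain ⟨k, rfl⟩ := exists_eq_add_mul e
      exact h.avoid _ _ hpq t ht k ⟨h1.le, le_rfl⟩
  | zero => simp
  | add x y _ _ hx hy => simp [hx, hy]
  | smul r x _ hx => simp [hx]

lemma eSet_notMem (h : MatchingState D a (b :: l) M B) : eSet D (arc D a b) ∉ spanB D B := by
  intro hv
  obtain ⟨h1, h2⟩ := h.lt_of_mem (t := b) (by simp)
  have := h.bdry_eq_zero hv (t := a) (by simp)
  rw [bdry_eSet_arc h1 h2] at this
  simp at this

lemma cast_inj (h : MatchingState D a l M B) {t s : ℤ} (ht : t ∈ a :: l) (hs : s ∈ a :: l)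
    (e : (t : ZMod (D + 1)) = s) : t = s := by
  have key : ∀ t ∈ a :: l, a - 1 < t ∧ t ≤ a - 1 + (D + 1) := by
    intro t ht
    rcases List.mem_cons.1 ht with rfl | ht
    · constructor <;> linarith
    · have := h.lt_of_mem ht
      constructor <;> linarith
  exact eq_of_cast_eq (key t ht).1 (key t ht).2 (key s hs).1 (key s hs).2 e

lemma nodup (h : MatchingState D a l M B) : (a :: l).Nodup := by
  have := h.pairwise
  rw [← List.cons_append] at this
  exact (List.pairwise_append.1 this).1.imp fun h => h.ne

lemma sum_map_bdry (h : MatchingState D a l M B) {y : Vsp D}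
    (hy : ∀ z, bdry D y z ≠ 0 → ∃ t ∈ a :: l, (t : ZMod (D + 1)) = z) :
    ((a :: l).map fun t : ℤ => bdry D y t).sum = 0 := by
  have hn : ((a :: l).map fun t : ℤ => (t : ZMod (D + 1))).Nodup :=
    h.nodup.map_on fun t ht s hs e => h.cast_inj ht hs e
  have e := List.sum_toFinset (bdry D y) hn
  rw [List.map_map] at e
  refine e.symm.trans (Eq.trans ?_ (sum_bdry y))
  refine Finset.sum_subset (Finset.subset_univ _) fun z _ hz => ?_
  by_contra hne
  obtain ⟨t, ht, rfl⟩ := hy z hne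
  exact hz (List.mem_toFinset.2 (List.mem_map_of_mem ht))

theorem cosetInd_mem {S : Submodule ℂ (Vsp D → ℂ)}
    (hS : ∀ B, _root_.phi D B → ind D (spanB D B) ∈ S) (n : ℕ) (hn : Odd n) :
    ∀ {a l M B}, MatchingState D a l M B → (a :: l).length = n → ∀ y : Vsp D,
      (∀ z, bdry D y z ≠ 0 → ∃ t ∈ a :: l, (t : ZMod (D + 1)) = z) → cosetInd D B y ∈ S := by
  induction n using Nat.strong_induction_on with
  | _ n ih =>
  intro a l M B h hl y hy
  refine cyclic_word_reduction (Q := fun w => ∀ {a l M B}, MatchingState D a l M B →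
    (a :: l).length = n → ∀ y : Vsp D,
      (∀ z, bdry D y z ≠ 0 → ∃ t ∈ a :: l, (t : ZMod (D + 1)) = z) →
      ((a :: l).map fun t : ℤ => bdry D y t) = w → cosetInd D B y ∈ S)
    ?_ ?_ ?_ _ (by rwa [List.length_map, hl]) (h.sum_map_bdry hy) h hl y hy rfl
  · intro x w hQ a l M B h hl y hy hw
    rcases l with _ | ⟨b, l⟩
    · obtain ⟨rfl, rfl⟩ : bdry D y a = x ∧ [] = w := by simpa using hw
      exact hQ h hl y hy rfl
    · refine hQ h.rotate (by simpa using hl) y ?_ ?_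
      · intro z hz
        obtain ⟨t, ht, rfl⟩ := hy z hz
        rcases List.mem_cons.1 ht with rfl | ht
        · exact ⟨t + (D + 1), by simp, cast_add_period D t⟩
        · exact ⟨t, by rw [← List.cons_append]; exact List.mem_append_left _ ht, rfl⟩
      · rw [List.map_cons, List.cons.injEq] at hw
        rw [← List.cons_append, List.map_append, hw.2, ← hw.1]
        simp only [List.map_cons, List.map_nil, cast_add_period]
  · intro x w hQ a l M B h hl y hy hw
    obtain ⟨b, c, l, rfl⟩ : ∃ b c l', l = b :: c :: l' := by
      rcases l with _ | ⟨b, _ | ⟨c, l⟩⟩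
      · simp at hw
      · simp at hl
        rw [← hl] at hn
        exact absurd hn (by decide)
      · exact ⟨b, c, l, rfl⟩
    obtain ⟨h1, h2⟩ := h.lt_of_mem (t := b) (by simp)
    set e := eSet D (arc D a b) with he
    have hbd : ∀ z, bdry D e z = if z = a ∨ z = b then 1 else 0 := bdry_eSet_arc h1 h2
    have hne : ∀ t ∈ c :: l, ¬ ((t : ZMod (D + 1)) = a ∨ (t : ZMod (D + 1)) = b) := by
      intro t ht hor
      have hnd := h.nodup
      simp only [List.nodup_cons] at hnd
      rcases hor with hor | hor
      · have := h.cast_inj (List.mem_cons_of_mem _ (List.mem_cons_of_mem _ ht)) (by simp) hor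
        subst this
        exact hnd.1 (List.mem_cons_of_mem _ ht)
      · have := h.cast_inj (List.mem_cons_of_mem _ (List.mem_cons_of_mem _ ht)) (by simp) hor
        subst this
        exact hnd.2.1 (by simpa using ht)
    simp only [List.map_cons, List.cons.injEq] at hw
    obtain ⟨wa, wb, wl⟩ := hw
    have hsupp : ∀ z, bdry D (y + e) z ≠ 0 → ∃ t ∈ a :: b :: c :: l, (t : ZMod (D + 1)) = z := by
      intro z hz
      by_cases hza : z = a ∨ z = b
      · rcases hza with rfl | rfl
        · exact ⟨a, by simp, rfl⟩
        · exact ⟨b, by simp, rfl⟩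
      · exact hy z (by simpa [hbd, hza] using hz)
    have hflip : cosetInd D B (y + e) ∈ S := by
      refine hQ h hl (y + e) hsupp ?_
      have hrest : ∀ t ∈ c :: l, bdry D (y + e) t = bdry D y t := fun t ht => by
        simp [hbd, hne t ht]
      have := List.map_congr_left hrest
      simp only [List.map_cons] at this
      simp only [List.map_cons, this, wl]
      simp [hbd, wa, wb]
    have hcut : ∀ y' : Vsp D, (∀ z, bdry D y' z ≠ 0 → ∃ t ∈ a :: b :: c :: l,
        (t : ZMod (D + 1)) = z) → bdry D y' a = 0 → bdry D y' b = 0 →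
        cosetInd D (insert (arc D a b) B) y' ∈ S := by
      intro y' hy' ha hb
      refine ih (n - 2) (by simp at hl; omega) ?_ h.cut (by simp at hl ⊢; omega) y' ?_
      · simp at hl
        rw [Nat.odd_iff] at hn ⊢
        omega
      · intro z hz
        obtain ⟨t, ht, rfl⟩ := hy' z hz
        rcases List.mem_cons.1 ht with rfl | ht
        · exact absurd ha hz
        rcases List.mem_cons.1 ht with rfl | ht
        · exact absurd hb hz
        · exact ⟨t, ht, rfl⟩
    have hsum : cosetInd D B y + cosetInd D B (y + e) ∈ S := by
      rcases eq_zero_or_one x with rfl | rfl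
      · rw [← cosetInd_insert h.eSet_notMem]
        exact hcut y hy wa wb
      · have := hcut (y + e) hsupp (by simp [hbd, wa, CharTwo.add_self_eq_zero])
          (by simp [hbd, wb, CharTwo.add_self_eq_zero])
        rwa [cosetInd_insert h.eSet_notMem, ← he, add_assoc, add_self_Vsp, add_zero,
          add_comm] at this
    exact (Submodule.add_mem_iff_left _ hflip).1 hsum
  · intro m a l M B h hl y hy hw
    have : y = 0 := by
      refine eq_zero_of_bdry_eq_zero (funext fun z => ?_)
      by_contra hne
      obtain ⟨t, ht, rfl⟩ := hy z hne
      have hm := List.mem_map_of_mem (f := fun t : ℤ => bdry D y t) ht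
      rw [hw] at hm
      exact hne (List.eq_of_mem_replicate hm)
    rw [this, cosetInd_zero]
    exact hS B h.phi

end MatchingState

instance (D : ℕ) : Finite (Vsp D) := Finite.of_surjective _ (Submodule.Quotient.mk_surjective _)

theorem span_ind_eq_top {D : ℕ} (hD : Even D) :
    Submodule.span ℂ (Set.range (fun B : {B : Finset (Finset (ZMod (D + 1))) // phi D B} =>
        ind D ↑(spanB D B.1))) = ⊤ := by
  classical
  have := Fintype.ofFinite (Vsp D)
  have key : ∀ y : Vsp D, Pi.single y 1 ∈
      Submodule.span ℂ (Set.range (fun B : {B : Finset (Finset (ZMod (D + 1))) // phi D B} =>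
        ind D ↑(spanB D B.1))) := by
    intro y
    rw [← cosetInd_empty]
    refine MatchingState.cosetInd_mem (fun B hB => Submodule.subset_span
      (Set.mem_range_self (⟨B, hB⟩ : {B // phi D B}))) (D + 1) hD.add_one (MatchingState.empty D) (by simp) y fun z _ => ?_
    obtain ⟨x, h1, h2, rfl⟩ := exists_lift (-1) z
    refine ⟨x, ?_, rfl⟩
    rcases eq_or_ne x 0 with rfl | h0
    · simp
    · refine List.mem_cons_of_mem _ (List.mem_map.2 ⟨(x - 1).toNat, ?_, ?_⟩)
      · rw [List.mem_range]
        omega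
      · omega
  rw [eq_top_iff, ← (Pi.basisFun ℂ (Vsp D)).span_eq, Submodule.span_le]
  rintro _ ⟨y, rfl⟩
  rw [Pi.basisFun_apply]
  exact key y

/-- The family `(1_{⟨B⟩})_{B ∈ φ(V_D)}` is a `ℂ`-basis of `ℂ[V_D]`; moreover
`ε(B') ∈ ⟨B⟩` implies `B' ≤ B`. -/
theorem new_basis (D : ℕ) (hD : 2 ≤ D) (hDev : Even D) :
    LinearIndependent ℂ
      (fun B : {B : Finset (Finset (ZMod (D + 1))) // phi D B} =>
        ind D ↑(spanB D B.1)) ∧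
    Submodule.span ℂ
      (Set.range (fun B : {B : Finset (Finset (ZMod (D + 1))) // phi D B} =>
        ind D ↑(spanB D B.1))) = ⊤ ∧
    ∀ B B' : Finset (Finset (ZMod (D + 1))), phi D B → phi D B' →
      epsB D B' ∈ spanB D B → leφ D B' B := by
  refine ⟨?_, span_ind_eq_top hDev, fun B B' hB hB' h =>
    ⟨1, fun s => if s = 0 then B' else B, by simp, by simp, fun s _ => ?_, fun s hs => ?_⟩⟩
  · classical
    have := Fintype.ofFinite (Vsp D)
    have := Fintype.ofFinite {B : Finset (Finset (ZMod (D + 1))) // phi D B}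
    refine linearIndependent_of_top_le_span_of_card_eq_finrank (span_ind_eq_top hDev).ge
      (le_antisymm ?_ ?_)
    · rw [Module.finrank_fintype_fun_eq_card, ← Nat.card_eq_fintype_card,
        ← Nat.card_eq_fintype_card]
      exact card_phi_le hDev
    · rw [← finrank_top, ← span_ind_eq_top hDev]
      exact finrank_range_le_card _
  · dsimp only
    split_ifs
    exacts [hB', hB]
  · obtain rfl : s = 0 := by omega
    simpa using h
end

section
/- Lemma 1.2(b): Let B ∈ φ(V_D) and i ∈ Z/(D+1) with {i} ∈ B. Suppose I₂ ∈ B satisfies i ∈ I₂, I₂ ≠ {i}, and I₂ ⊆ J for every J ∈ B with i ∈ J and J ≠ {i}; and suppose I₃ ∈ B satisfies i ∈ I₃, I₂ ⊊ I₃, and I₃ ⊆ J for every J ∈ B with i ∈ J and I₂ ⊊ J. Then i ∈ I₃^odd. -/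
open scoped BigOperators

/-- The set of residues `a + t` with `s ≤ t < e`. -/
def seg (D : ℕ) (a : ZMod (D + 1)) (s e : ℕ) : Finset (ZMod (D + 1)) :=
  (Finset.Ico s e).image (fun t : ℕ => a + (t : ZMod (D + 1)))

theorem add_natCast_inj {D : ℕ} {a : ZMod (D + 1)} {m n : ℕ} (hm : m ≤ D) (hn : n ≤ D)
    (h : a + (m : ZMod (D + 1)) = a + n) : m = n := by
  have h := congrArg ZMod.val (add_left_cancel h)
  rwa [ZMod.val_natCast_of_lt (by omega), ZMod.val_natCast_of_lt (by omega)] at h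

theorem mem_seg {D : ℕ} {a : ZMod (D + 1)} {s e n : ℕ} (he : e ≤ D + 1) (hn : n ≤ D) :
    a + (n : ZMod (D + 1)) ∈ seg D a s e ↔ s ≤ n ∧ n < e := by
  simp only [seg, Finset.mem_image, Finset.mem_Ico]
  constructor
  · rintro ⟨t, ht, h⟩
    have := add_natCast_inj (by omega) hn h
    omega
  · exact fun h => ⟨n, h, rfl⟩

theorem exists_of_mem_seg {D : ℕ} {a x : ZMod (D + 1)} {s e : ℕ} (h : x ∈ seg D a s e) :
    ∃ n, s ≤ n ∧ n < e ∧ x = a + (n : ZMod (D + 1)) := by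
  simp only [seg, Finset.mem_image, Finset.mem_Ico] at h
  obtain ⟨t, ht, h⟩ := h
  exact ⟨t, ht.1, ht.2, h.symm⟩

theorem card_seg {D : ℕ} {a : ZMod (D + 1)} {s e : ℕ} (he : e ≤ D + 1) :
    (seg D a s e).card = e - s := by
  rw [seg, Finset.card_image_of_injOn, Nat.card_Ico]
  intro m hm n hn h
  simp only [Finset.coe_Ico, Set.mem_Ico] at hm hn
  exact add_natCast_inj (by omega) (by omega) h

theorem seg_union {D : ℕ} {a : ZMod (D + 1)} {s m e : ℕ} (hs : s ≤ m) (he : m ≤ e) :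
    seg D a s m ∪ seg D a m e = seg D a s e := by
  rw [seg, seg, seg, ← Finset.image_union, Finset.Ico_union_Ico_eq_Ico hs he]

theorem isInterval_seg {D : ℕ} (a : ZMod (D + 1)) {s e : ℕ} (hs : s < e) (he : e ≤ D) :
    IsInterval D (seg D a s e) := by
  refine ⟨a + s, e - s, by omega, by omega, ?_⟩
  ext x
  simp only [seg, Finset.mem_image, Finset.mem_Ico, Finset.mem_range]
  constructor
  · rintro ⟨t, ht, rfl⟩
    refine ⟨t - s, by omega, ?_⟩
    rw [add_assoc, ← Nat.cast_add, Nat.add_sub_cancel' ht.1]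
  · rintro ⟨t, ht, rfl⟩
    exact ⟨s + t, by omega, by push_cast; ring⟩

theorem oddInterval_seg {D : ℕ} (a : ZMod (D + 1)) {s e : ℕ} (he : e ≤ D)
    (ho : Odd (e - s)) : OddInterval D (seg D a s e) := by
  refine ⟨isInterval_seg a ?_ he, by rwa [card_seg (by omega)]⟩
  have := ho.pos
  omega

theorem IsInterval.exists_seg {D : ℕ} {J : Finset (ZMod (D + 1))} (h : IsInterval D J) :
    ∃ a l, 1 ≤ l ∧ l ≤ D ∧ J = seg D a 0 l := by
  obtain ⟨a, l, h1, h2, h⟩ := h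
  exact ⟨a, l, h1, h2, by rw [h, seg, Finset.range_eq_Ico]⟩

/-- An arc contained in a proper segment is a subsegment. -/
theorem IsInterval.exists_subseg {D : ℕ} {a : ZMod (D + 1)} {s e : ℕ} (he : e ≤ D)
    {J : Finset (ZMod (D + 1))} (h : IsInterval D J) (hJ : J ⊆ seg D a s e) :
    ∃ s' e', s ≤ s' ∧ s' < e' ∧ e' ≤ e ∧ J = seg D a s' e' := by
  obtain ⟨j, l, h1, h2, rfl⟩ := h
  have hmem : ∀ t < l, j + (t : ZMod (D + 1)) ∈ seg D a s e := fun t ht =>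
    hJ (Finset.mem_image.2 ⟨t, Finset.mem_range.2 ht, rfl⟩)
  obtain ⟨n, hn1, hn2, hn⟩ := exists_of_mem_seg (hmem 0 (by omega))
  rw [Nat.cast_zero, add_zero] at hn
  subst hn
  have hle : n + l ≤ e := by
    by_contra! hlt
    have := hmem (e - n) (by omega)
    rw [add_assoc, ← Nat.cast_add, Nat.add_sub_cancel' hn2.le, mem_seg (by omega) he] at this
    omega
  refine ⟨n, n + l, hn1, by omega, hle, ?_⟩
  ext x
  simp only [seg, Finset.mem_image, Finset.mem_Ico, Finset.mem_range]
  constructor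
  · rintro ⟨t, ht, rfl⟩
    exact ⟨n + t, by omega, by push_cast; ring⟩
  · rintro ⟨t, ht, rfl⟩
    refine ⟨t - n, by omega, ?_⟩
    rw [add_assoc, ← Nat.cast_add, Nat.add_sub_cancel' ht.1]

theorem mem_evSet {D : ℕ} {I : Finset (ZMod (D + 1))} {x : ZMod (D + 1)} :
    x ∈ evSet D I ↔ x ∈ I ∧ ∃ I' I'', OddInterval D I' ∧ OddInterval D I'' ∧
      Spade D I' I'' ∧ I.erase x = I' ∪ I'' := by
  simp [evSet]

theorem mem_evSet_seg_of_odd {D : ℕ} {a : ZMod (D + 1)} {s e n : ℕ} (he : e ≤ D)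
    (ho : Odd (e - s)) (hs : s ≤ n) (hn : n < e) (hodd : Odd (n - s)) :
    a + (n : ZMod (D + 1)) ∈ evSet D (seg D a s e) := by
  have hpos := hodd.pos
  have ho' : Odd (e - (n + 1)) := by
    rw [Nat.odd_iff] at *; omega
  have hpos' := ho'.pos
  have hu : (seg D a s e).erase (a + (n : ZMod (D + 1))) =
      seg D a s n ∪ seg D a (n + 1) e := by
    ext x
    rw [Finset.mem_erase, Finset.mem_union]
    constructor
    · rintro ⟨hx, hm⟩
      obtain ⟨m, h1, h2, rfl⟩ := exists_of_mem_seg hm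
      have : m ≠ n := fun h => hx (by rw [h])
      rw [mem_seg (by omega) (by omega), mem_seg (by omega) (by omega)]
      omega
    · rintro (hm | hm) <;>
      · obtain ⟨m, h1, h2, rfl⟩ := exists_of_mem_seg hm
        refine ⟨fun h => ?_, (mem_seg (by omega) (by omega)).2 (by omega)⟩
        have := add_natCast_inj (by omega) (by omega) h
        omega
  refine mem_evSet.2 ⟨(mem_seg (by omega) (by omega)).2 ⟨hs, hn⟩, _, _,
    oddInterval_seg a (by omega) hodd, oddInterval_seg a he ho', ⟨?_, fun hint => ?_⟩, hu⟩
  · rw [← Finset.disjoint_iff_inter_eq_empty, Finset.disjoint_left]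
    intro x hx hx'
    obtain ⟨m, h1, h2, rfl⟩ := exists_of_mem_seg hx
    rw [mem_seg (by omega) (by omega)] at hx'
    omega
  · rw [← hu] at hint
    obtain ⟨s', e', h1, h2, h3, h⟩ := hint.exists_subseg he (Finset.erase_subset _ _)
    have key : ∀ m, s ≤ m → m < e → m ≠ n → s' ≤ m ∧ m < e' := by
      intro m hm1 hm2 hmn
      rw [← mem_seg (D := D) (a := a) (by omega) (by omega), ← h, Finset.mem_erase,
        mem_seg (by omega) (by omega)]
      exact ⟨fun h => hmn (add_natCast_inj (by omega) (by omega) h), hm1, hm2⟩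
    have k1 := key s le_rfl (by omega) (by omega)
    have k2 := key (e - 1) (by omega) (by omega) (by omega)
    have : a + (n : ZMod (D + 1)) ∈ (seg D a s e).erase (a + (n : ZMod (D + 1))) := by
      rw [h, mem_seg (by omega) (by omega)]
      omega
    simp at this

theorem Spade.symm {D : ℕ} {I J : Finset (ZMod (D + 1))} (h : Spade D I J) : Spade D J I := by
  rwa [Spade, Finset.inter_comm, Finset.union_comm]

theorem odd_of_mem_evSet_seg {D : ℕ} {a : ZMod (D + 1)} {s e n : ℕ} (he : e ≤ D)
    (hs : s ≤ n) (hn : n < e) (h : a + (n : ZMod (D + 1)) ∈ evSet D (seg D a s e)) :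
    Odd (n - s) := by
  obtain ⟨-, I', I'', ⟨i1, o1⟩, ⟨i2, o2⟩, sp, hu⟩ := mem_evSet.1 h
  wlog hlt : a + (s : ZMod (D + 1)) ∈ I' ∨ n = s generalizing I' I''
  · push Not at hlt
    refine this I'' I' i2 o2 i1 o1 sp.symm (by rw [hu, Finset.union_comm]) (.inl ?_)
    have : a + (s : ZMod (D + 1)) ∈ (seg D a s e).erase (a + (n : ZMod (D + 1))) := by
      rw [Finset.mem_erase, mem_seg (by omega) (by omega)]
      exact ⟨fun h => hlt.2 (add_natCast_inj (by omega) (by omega) h).symm, by omega⟩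
    rw [hu, Finset.mem_union] at this
    exact this.resolve_left hlt.1
  have hsub : I' ∪ I'' ⊆ seg D a s e := hu ▸ Finset.erase_subset _ _
  obtain ⟨s1, e1, h1, h2, h3, rfl⟩ :=
    i1.exists_subseg he (Finset.subset_union_left.trans hsub)
  obtain ⟨s2, e2, k1, k2, k3, rfl⟩ :=
    i2.exists_subseg he (Finset.subset_union_right.trans hsub)
  have key : ∀ m, s ≤ m → m < e → (m ≠ n ↔ (s1 ≤ m ∧ m < e1) ∨ (s2 ≤ m ∧ m < e2)) := by
    intro m hm1 hm2
    rw [← mem_seg (D := D) (a := a) (by omega) (by omega),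
      ← mem_seg (D := D) (a := a) (s := s2) (by omega) (by omega), ← Finset.mem_union, ← hu,
      Finset.mem_erase, mem_seg (by omega) (by omega)]
    exact ⟨fun h => ⟨fun h' => h (add_natCast_inj (by omega) (by omega) h'), hm1, hm2⟩,
      fun h h' => h.1 (by rw [h'])⟩
  have hdisj : ∀ m, s ≤ m → m < e → ¬ ((s1 ≤ m ∧ m < e1) ∧ (s2 ≤ m ∧ m < e2)) := by
    intro m hm1 hm2
    rw [← mem_seg (D := D) (a := a) (by omega) (by omega),
      ← mem_seg (D := D) (a := a) (s := s2) (by omega) (by omega), ← Finset.mem_inter, sp.1]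
    simp
  have nadj : e1 ≠ s2 := by
    rintro rfl
    exact sp.2 (seg_union h2.le k2.le ▸ isInterval_seg a (by omega) (by omega))
  have nadj' : e2 ≠ s1 := by
    rintro rfl
    refine sp.2 ?_
    rw [Finset.union_comm, seg_union k2.le h2.le]
    exact isInterval_seg a (by omega) (by omega)
  have kn := key n hs hn
  have d1 := hdisj s1 (by omega) (by omega)
  have d2 := hdisj s2 (by omega) (by omega)
  rcases hlt with hlt | rfl
  · rw [mem_seg (by omega) (by omega)] at hlt
    obtain rfl : s1 = s := by omega
    have ke : e1 < e → (e1 ≠ n ↔ _) := fun hh => key e1 (by omega) hh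
    obtain rfl : e1 = n := by omega
    rwa [card_seg (by omega)] at o1
  · have a1 : e1 < e → (e1 ≠ n ↔ _) := fun hh => key e1 (by omega) hh
    have a2 : e2 < e → (e2 ≠ n ↔ _) := fun hh => key e2 (by omega) hh
    omega

/-- Two members of `B` inside a common arc are never adjacent. -/
theorem phi.not_adjacent_s9 {D : ℕ} {B : Finset (Finset (ZMod (D + 1)))} (hB : phi D B)
    {a : ZMod (D + 1)} {s e n : ℕ} (he : e ≤ D) {J K : Finset (ZMod (D + 1))}
    (hJ : J ∈ B) (hK : K ∈ B) (hJs : J ⊆ seg D a s e) (hKs : K ⊆ seg D a s e)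
    (hn : n + 1 < e)
    (h1 : a + (n : ZMod (D + 1)) ∈ J) (h2 : a + ((n + 1 : ℕ) : ZMod (D + 1)) ∈ K)
    (h3 : a + (n : ZMod (D + 1)) ∉ K) (h4 : a + ((n + 1 : ℕ) : ZMod (D + 1)) ∉ J) :
    False := by
  rcases hB.2.1 J hJ K hK with h | h | h | h
  · exact h3 (h ▸ h1)
  · obtain ⟨s1, e1, p1, p2, p3, rfl⟩ := (hB.1 J hJ).1.exists_subseg he hJs
    obtain ⟨s2, e2, q1, q2, q3, rfl⟩ := (hB.1 K hK).1.exists_subseg he hKs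
    rw [mem_seg (by omega) (by omega)] at h1 h2 h3 h4
    obtain rfl : e1 = s2 := by omega
    exact h.2 (seg_union p2.le q2.le ▸ isInterval_seg a (by omega) (by omega))
  · exact h3 (h.1.1 h1)
  · exact h4 (h.1.1 h2)

/-- `(P1)` in coordinates: the odd positions of a member of `B` are covered by smaller members
of `B`. -/
theorem phi.exists_cover_s9 {D : ℕ} {B : Finset (Finset (ZMod (D + 1)))} (hB : phi D B)
    {a : ZMod (D + 1)} {s e n : ℕ} (he : e ≤ D) (hI : seg D a s e ∈ B)
    (hs : s ≤ n) (hn : n < e) (hodd : Odd (n - s)) :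
    ∃ J ∈ B, J ⊂ seg D a s e ∧ a + (n : ZMod (D + 1)) ∈ J := by
  obtain ⟨𝒥, hsub, hprec, -, hcov⟩ := hB.2.2 _ hI
  have ho : Odd (e - s) := by simpa [card_seg (show e ≤ D + 1 by omega)] using (hB.1 _ hI).2
  obtain ⟨J, hJ, hm⟩ := Finset.mem_biUnion.1 (hcov (mem_evSet_seg_of_odd he ho hs hn hodd))
  exact ⟨J, hsub hJ, (hprec J hJ).1, hm⟩

/-- If `{i} ∈ B`, then `i` is at an odd position of the next larger member of `B`. -/
theorem phi.odd_of_singleton_mem {D : ℕ} {B : Finset (Finset (ZMod (D + 1)))} (hB : phi D B)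
    {a : ZMod (D + 1)} {s e n : ℕ} (he : e ≤ D) (hs : s ≤ n) (hn : n < e)
    (hi : {a + (n : ZMod (D + 1))} ∈ B) (hI : seg D a s e ∈ B)
    (hne : seg D a s e ≠ {a + (n : ZMod (D + 1))})
    (hmin : ∀ J ∈ B, a + (n : ZMod (D + 1)) ∈ J → J ≠ {a + (n : ZMod (D + 1))} →
      seg D a s e ⊆ J) :
    Odd (n - s) := by
  by_contra hev
  have ho : Odd (e - s) := by simpa [card_seg (show e ≤ D + 1 by omega)] using (hB.1 _ hI).2
  have hmem : a + (n : ZMod (D + 1)) ∈ seg D a s e := (mem_seg (by omega) (by omega)).2 ⟨hs, hn⟩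
  have hone : e - s ≠ 1 := fun h => by
    obtain ⟨x, hx⟩ := Finset.card_eq_one.1 ((card_seg (a := a) (by omega)).trans h)
    rw [hx, Finset.mem_singleton] at hmem
    exact hne (by rw [hx, hmem])
  have hnot : ∀ m, m < e → m ≠ n → a + (m : ZMod (D + 1)) ∉
      ({a + (n : ZMod (D + 1))} : Finset (ZMod (D + 1))) := by
    intro m hm hmn h
    exact hmn (add_natCast_inj (by omega) (by omega) (Finset.mem_singleton.1 h))
  have hJn : ∀ m, m < e → m ≠ n → ∀ J ∈ B, J ⊂ seg D a s e → a + (m : ZMod (D + 1)) ∈ J →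
      a + (n : ZMod (D + 1)) ∉ J := fun m hm hmn J hJ hss hmJ hnJ =>
    hss.2 (hmin J hJ hnJ fun h => hnot m hm hmn (h ▸ hmJ))
  have hsing := Finset.singleton_subset_iff.2 hmem
  by_cases hlt : n + 1 < e
  · obtain ⟨J, hJ, hss, hm⟩ := hB.exists_cover_s9 (n := n + 1) he hI
      (by omega) hlt (by rw [Nat.odd_iff] at *; omega)
    exact hB.not_adjacent_s9 he hi hJ hsing hss.1 hlt (Finset.mem_singleton_self _) hm
      (hJn _ hlt (by omega) J hJ hss hm) (hnot _ hlt (by omega))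
  · obtain ⟨J, hJ, hss, hm⟩ := hB.exists_cover_s9 (n := n - 1) he hI
      (by omega) (by omega) (by rw [Nat.odd_iff] at *; omega)
    have hn' : n - 1 + 1 = n := by omega
    exact hB.not_adjacent_s9 he hJ hi hss.1 hsing (n := n - 1) (by omega) hm
      (by rw [hn']; exact Finset.mem_singleton_self _) (hnot _ (by omega) (by omega))
      (by rw [hn']; exact hJn _ (by omega) (by omega) J hJ hss hm)

/-- Lemma 1.2(b): if `{i} ∈ B`, `I₂` is the smallest element of `B` containing `i`
other than `{i}`, and `I₃` is the smallest element of `B` strictly containing `I₂`,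
then `i ∈ I₃^odd`. -/
theorem lemma_1_2_b (D : ℕ) (hD : 2 ≤ D) (hDev : Even D)
    (B : Finset (Finset (ZMod (D + 1)))) (hB : phi D B) (i : ZMod (D + 1))
    (hi : {i} ∈ B) (I₂ : Finset (ZMod (D + 1))) (hI₂B : I₂ ∈ B) (hiI₂ : i ∈ I₂)
    (hne : I₂ ≠ {i}) (hmin : ∀ J ∈ B, i ∈ J → J ≠ {i} → I₂ ⊆ J)
    (I₃ : Finset (ZMod (D + 1))) (hI₃B : I₃ ∈ B) (hiI₃ : i ∈ I₃) (hI₂I₃ : I₂ ⊂ I₃)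
    (hmin₃ : ∀ J ∈ B, i ∈ J → I₂ ⊂ J → I₃ ⊆ J) :
    i ∈ I₃ \ evSet D I₃ := by
  rw [Finset.mem_sdiff]
  refine ⟨hiI₃, fun hev => ?_⟩
  obtain ⟨a, l, -, hl, rfl⟩ := (hB.1 _ hI₃B).1.exists_seg
  obtain ⟨s, e, -, hse, hel, rfl⟩ := (hB.1 _ hI₂B).1.exists_subseg hl hI₂I₃.1
  obtain ⟨n, hsn, hne', rfl⟩ := exists_of_mem_seg hiI₂
  have hodd₂ : Odd (n - s) := hB.odd_of_singleton_mem (by omega) hsn hne' hi hI₂B hne hmin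
  have hodd₃ : Odd (n - 0) := odd_of_mem_evSet_seg hl (by omega) (by omega) hev
  have ho₂ : Odd (e - s) := by
    simpa [card_seg (show e ≤ D + 1 by omega)] using (hB.1 _ hI₂B).2
  have ho₃ : Odd (l - 0) := by
    simpa [card_seg (show l ≤ D + 1 by omega)] using (hB.1 _ hI₃B).2
  -- a smaller member of `B` containing a position outside `I₂` avoids `i`
  have havoid : ∀ m, m < l → ¬ (s ≤ m ∧ m < e) → ∀ K ∈ B, K ⊂ seg D a 0 l →
      a + (m : ZMod (D + 1)) ∈ K →
      a + (n : ZMod (D + 1)) ∉ K := by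
    intro m hm hms K hK hss hmK hnK
    by_cases hKi : K = {a + (n : ZMod (D + 1))}
    · rw [hKi, Finset.mem_singleton] at hmK
      have := add_natCast_inj (by omega) (by omega) hmK
      omega
    · have hsubK := hmin K hK hnK hKi
      refine hss.2 (hmin₃ K hK hnK (hsubK.ssubset_of_ne ?_))
      rintro rfl
      exact hms ((mem_seg (by omega) (by omega)).1 hmK)
  -- a smaller member of `B` that meets the complement of `I₂` is disjoint from `I₂`
  have hsep : ∀ m m', m < l → ¬ (s ≤ m ∧ m < e) → ∀ K ∈ B, K ⊂ seg D a 0 l →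
      a + (m : ZMod (D + 1)) ∈ K →
      a + (m' : ZMod (D + 1)) ∈ seg D a s e → a + (m' : ZMod (D + 1)) ∉ K := by
    intro m m' hm hms K hK hss hmK hm' hmK'
    rcases hB.2.1 K hK _ hI₂B with h | h | h | h
    · exact havoid m hm hms K hK hss hmK (h ▸ hiI₂)
    · have : a + (m' : ZMod (D + 1)) ∈ K ∩ seg D a s e := Finset.mem_inter.2 ⟨hmK', hm'⟩
      rw [h.1] at this
      simp at this
    · exact hms ((mem_seg (by omega) (by omega)).1 (h.1.1 hmK))
    · exact havoid m hm hms K hK hss hmK (h.1.1 hiI₂)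
  have hs0 : s = 0 := by
    by_contra hs0
    obtain ⟨K, hK, hss, hmK⟩ := hB.exists_cover_s9 (n := s - 1) hl hI₃B
      (by omega) (by omega) (by rw [Nat.odd_iff] at *; omega)
    have hs' : s - 1 + 1 = s := by omega
    have hms : a + (s : ZMod (D + 1)) ∈ seg D a s e := by
      rw [mem_seg (by omega) (by omega)]; omega
    exact hB.not_adjacent_s9 hl hK hI₂B hss.1 hI₂I₃.1 (n := s - 1) (by omega) hmK
      (by rwa [hs']) (by rw [mem_seg (by omega) (by omega)]; omega)
      (by rw [hs']; exact hsep _ _ (by omega) (by omega) K hK hss hmK hms)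
  have hel' : e = l := by
    by_contra hel'
    obtain ⟨K, hK, hss, hmK⟩ := hB.exists_cover_s9 (n := e) hl hI₃B
      (by omega) (by omega) (by rw [Nat.odd_iff] at *; omega)
    have he' : e - 1 + 1 = e := by omega
    have hms : a + ((e - 1 : ℕ) : ZMod (D + 1)) ∈ seg D a s e := by
      rw [mem_seg (by omega) (by omega)]; omega
    exact hB.not_adjacent_s9 hl hI₂B hK hI₂I₃.1 hss.1 (n := e - 1) (by omega) hms
      (by rwa [he']) (hsep _ _ (by omega) (by omega) K hK hss hmK hms)
      (by rw [he', mem_seg (by omega) (by omega)]; omega)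
  exact hI₂I₃.ne (by rw [hs0, hel'])
end
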